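/- Let K be a valued field whose value group has a least positive element, regarded as an L_VR-structure, and suppose K is elementarily equivalent to ℂ((t)) (with its t-adic valuation) as L_VR-structures. Then for every subset Y ⊆ O_K definable in K by an L_VR-formula with parameters from K, there exists a finite set Z ⊆ k such that either Y ⊆ res⁻¹(Z) or res⁻¹(k ∖ Z) ⊆ Y. In particular, res(Y) is either finite or cofinite in k. -/

import Mathlib

open FirstOrder

/-- The function symbols of the language `L_VR`: the ring language `{0, 1, +, ×}`. -/
inductive LVRFunc : ℕ → Type
  | zero : LVRFunc 0
  | one : LVRFunc 0
  | add : LVRFunc 2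
  | mul : LVRFunc 2

/-- The relation symbols of the language `L_VR`: a binary divisibility relation `|`,
a unary relation `N`, and a unary relation `P_n` for each `n ≥ 1`. -/
inductive LVRRel : ℕ → Type
  | dvd : LVRRel 2
  | N : LVRRel 1
  | pow : ℕ+ → LVRRel 1

/-- The first-order language `L_VR` of valuation rings. -/
def LVR : FirstOrder.Language where
  Functions := LVRFunc
  Relations := LVRRel

/-- Interpretation of the `L_VR` function symbols in a field. -/
def LVRfun (K : Type*) [Field K] : ∀ {n : ℕ}, LVRFunc n → (Fin n → K) → K
  | _, .zero => fun _ => 0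
  | _, .one => fun _ => 1
  | _, .add => fun x => x 0 + x 1
  | _, .mul => fun x => x 0 * x 1

/-- Interpretation of the `L_VR` relation symbols in a valued field (Mathlib's
multiplicative convention for valuations is order-reversing w.r.t. the additive
convention of the paper: `x | y` means `v_add(x) ≤ v_add(y)`, i.e. multiplicatively
`v (x 1) ≤ v (x 0)`; `N x` means `v_add(x) = 1_Γ`, where `γ₁` is the multiplicative
avatar of the least positive element of the value group; `P_n x` means `x` is an
`n`-th power). -/
def LVRrel {K : Type*} [Field K] {Γ₀ : Type*} [LinearOrderedCommGroupWithZero Γ₀]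
    (v : Valuation K Γ₀) (γ₁ : Γ₀) : ∀ {n : ℕ}, LVRRel n → (Fin n → K) → Prop
  | _, .dvd => fun x => v (x 1) ≤ v (x 0)
  | _, .N => fun x => v (x 0) = γ₁
  | _, .pow m => fun x => ∃ y : K, x 0 = y ^ (m : ℕ)

/-- A valued field, together with the (multiplicative avatar of the) least positive
element of its value group, as an `L_VR`-structure. -/
def valuedStructure {K : Type*} [Field K] {Γ₀ : Type*} [LinearOrderedCommGroupWithZero Γ₀]
    (v : Valuation K Γ₀) (γ₁ : Γ₀) : LVR.Structure K where
  funMap := LVRfun K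
  RelMap := LVRrel v γ₁

/-- `γ₁` is the multiplicative avatar of the least positive element of the value
group: the greatest element of `Γ₀ ∖ {0}` that is `< 1`. -/
def IsLeastPos {Γ₀ : Type*} [LinearOrderedCommGroupWithZero Γ₀] (γ₁ : Γ₀) : Prop :=
  γ₁ ≠ 0 ∧ γ₁ < 1 ∧ ∀ δ : Γ₀, δ ≠ 0 → δ < 1 → δ ≤ γ₁

/-- `ℂ((t))`, the field of formal Laurent series over `ℂ` with its `t`-adic
valuation, as an `L_VR`-structure. -/
noncomputable def laurentStructure : LVR.Structure (LaurentSeries ℂ) :=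
  valuedStructure (Valued.v : Valuation (LaurentSeries ℂ) (WithZero (Multiplicative ℤ)))
    ((Multiplicative.ofAdd (-1 : ℤ) : Multiplicative ℤ) : WithZero (Multiplicative ℤ))

section Tameness

open Polynomial

/-- The order of a Laurent series, with value `⊤` at zero. -/
noncomputable abbrev ord (x : LaurentSeries ℂ) : WithTop ℤ := HahnSeries.orderTop x
/-- The angular component (leading coefficient) of a Laurent series. -/
noncomputable abbrev ac (x : LaurentSeries ℂ) : ℂ := HahnSeries.leadingCoeff x

theorem ac_eq_zero_iff_ord_eq_top (x : LaurentSeries ℂ) : ac x = 0 ↔ ord x = ⊤ := by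
  simp [ac, ord]

theorem exists_ord_ac (γ : WithTop ℤ) (z : ℂ) (h : z = 0 ↔ γ = ⊤) :
    ∃ u : LaurentSeries ℂ, ord u = γ ∧ ac u = z := by
  by_cases hz : z = 0
  · exact ⟨0, by simp [ord, h.1 hz], by simp [ac, hz]⟩
  · lift γ to ℤ using fun e => hz (h.2 e)
    exact ⟨HahnSeries.single γ z, HahnSeries.orderTop_single hz, HahnSeries.leadingCoeff_of_single⟩

theorem ord_mul (x y : LaurentSeries ℂ) : ord (x * y) = ord x + ord y :=
  HahnSeries.orderTop_mul x y

theorem ac_mul (x y : LaurentSeries ℂ) : ac (x * y) = ac x * ac y :=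
  HahnSeries.leadingCoeff_mul x y

theorem ord_pow (x : LaurentSeries ℂ) (n : ℕ) : ord (x ^ n) = n • ord x := by
  induction n with
  | zero => simp [ord]
  | succ n ih => rw [pow_succ, ord_mul, ih, succ_nsmul]

theorem ac_pow (x : LaurentSeries ℂ) (n : ℕ) : ac (x ^ n) = ac x ^ n := by
  induction n with
  | zero => simp [ac]
  | succ n ih => rw [pow_succ, ac_mul, ih, pow_succ]

theorem coeff_of_le_ord {x : LaurentSeries ℂ} {m : ℤ} (h : (m : WithTop ℤ) ≤ ord x) :
    x.coeff m = if ord x = m then ac x else 0 := by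
  split_ifs with h'
  · have hx : x ≠ 0 := by rintro rfl; simp [ord] at h'
    rw [ac, HahnSeries.leadingCoeff_eq]
    congr 1
    have := HahnSeries.order_eq_orderTop_of_ne_zero hx
    rw [show x.orderTop = m from h'] at this
    exact_mod_cast this.symm
  · exact HahnSeries.coeff_eq_zero_of_lt_orderTop (lt_of_le_of_ne h (Ne.symm h'))

theorem le_ord_iff {x : LaurentSeries ℂ} {m : ℤ} :
    (m : WithTop ℤ) ≤ ord x ↔ ∀ n : ℤ, n < m → x.coeff n = 0 := by
  constructor
  · intro h n hn
    exact HahnSeries.coeff_eq_zero_of_lt_orderTop (lt_of_lt_of_le (by exact_mod_cast hn) h)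
  · intro h
    by_contra! hlt
    obtain ⟨n, hn⟩ := WithTop.ne_top_iff_exists.1 hlt.ne_top
    rw [← hn] at hlt
    exact HahnSeries.coeff_orderTop_ne hn.symm (h n (by exact_mod_cast hlt))

theorem ord_eq_and_ac_eq {x : LaurentSeries ℂ} {m : ℤ} (h : (m : WithTop ℤ) ≤ ord x)
    (h0 : x.coeff m ≠ 0) : ord x = m ∧ ac x = x.coeff m := by
  rw [coeff_of_le_ord h] at h0 ⊢
  split_ifs at h0 ⊢ with h'
  · exact ⟨h', rfl⟩
  · exact absurd rfl h0

theorem le_ord_sum {ι : Type*} (s : Finset ι) (x : ι → LaurentSeries ℂ) {m : ℤ}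
    (h : ∀ i ∈ s, (m : WithTop ℤ) ≤ ord (x i)) : (m : WithTop ℤ) ≤ ord (∑ i ∈ s, x i) := by
  rw [le_ord_iff]
  intro n hn
  rw [HahnSeries.coeff_sum]
  exact Finset.sum_eq_zero fun i hi => le_ord_iff.1 (h i hi) n hn

theorem lt_ord_sub {x y : LaurentSeries ℂ} {m : ℤ} (hx : ord x = m) (hy : ord y = m)
    (h : ac x = ac y) : (m : WithTop ℤ) < ord (x - y) := by
  have h1 : (m : WithTop ℤ) ≤ ord (x - y) := by
    rw [le_ord_iff]
    intro n hn
    rw [HahnSeries.coeff_sub, le_ord_iff.1 hx.ge n hn, le_ord_iff.1 hy.ge n hn, sub_zero]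
  refine lt_of_le_of_ne h1 fun e => ?_
  refine HahnSeries.coeff_orderTop_ne e.symm ?_
  rw [HahnSeries.coeff_sub, coeff_of_le_ord hx.ge, coeff_of_le_ord hy.ge, if_pos hx, if_pos hy, h,
    sub_self]

section initialForm

variable {N : ℕ}

/-- The least order among the terms `c i * u ^ i`, when `e i = ord (c i)` and `γ = ord u`. -/
noncomputable def minOrd (e : Fin (N + 1) → WithTop ℤ) (γ : WithTop ℤ) : WithTop ℤ :=
  Finset.univ.inf fun i => e i + (i : ℕ) • γ

open Classical in
/-- The indices at which the least order is attained. -/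
noncomputable def leadSet (e : Fin (N + 1) → WithTop ℤ) (γ : WithTop ℤ) : Finset (Fin (N + 1)) :=
  Finset.univ.filter fun i => e i + (i : ℕ) • γ = minOrd e γ

/-- The polynomial supported on `I` with coefficients `a`. -/
noncomputable def initPoly (I : Finset (Fin (N + 1))) (a : Fin (N + 1) → ℂ) : ℂ[X] :=
  ∑ i ∈ I, monomial (i : ℕ) (a i)

theorem initPoly_coeff (I : Finset (Fin (N + 1))) (a : Fin (N + 1) → ℂ) (i : Fin (N + 1)) :
    (initPoly I a).coeff i = if i ∈ I then a i else 0 := by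
  simp only [initPoly, finsetSum_coeff, coeff_monomial, Fin.val_inj]
  simp

theorem initPoly_coeff_of_lt (I : Finset (Fin (N + 1))) (a : Fin (N + 1) → ℂ) {i : ℕ}
    (hi : N < i) : (initPoly I a).coeff i = 0 := by
  simp only [initPoly, finsetSum_coeff, coeff_monomial]
  exact Finset.sum_eq_zero fun j _ => if_neg (by have := j.2; omega)

theorem minOrd_le (e : Fin (N + 1) → WithTop ℤ) (γ : WithTop ℤ) (i : Fin (N + 1)) :
    minOrd e γ ≤ e i + (i : ℕ) • γ := Finset.inf_le (Finset.mem_univ i)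

theorem exists_mem_leadSet (e : Fin (N + 1) → WithTop ℤ) (γ : WithTop ℤ) :
    ∃ i, i ∈ leadSet e γ := by
  obtain ⟨i, -, hi⟩ := Finset.exists_mem_eq_inf (Finset.univ : Finset (Fin (N + 1)))
    Finset.univ_nonempty (fun i => e i + (i : ℕ) • γ)
  exact ⟨i, by simp [leadSet, minOrd, hi]⟩

theorem mem_leadSet {e : Fin (N + 1) → WithTop ℤ} {γ : WithTop ℤ} {i : Fin (N + 1)} :
    i ∈ leadSet e γ ↔ e i + (i : ℕ) • γ = minOrd e γ := by simp [leadSet]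

/-- The orders of the coefficients of `q`. -/
noncomputable def coeffOrd (N : ℕ) (q : (LaurentSeries ℂ)[X]) (i : Fin (N + 1)) : WithTop ℤ :=
  ord (q.coeff i)

/-- The angular components of the coefficients of `q`. -/
noncomputable def coeffAc (N : ℕ) (q : (LaurentSeries ℂ)[X]) (i : Fin (N + 1)) : ℂ :=
  ac (q.coeff i)

/-- The initial form of `q` with respect to the weight `γ`. -/
noncomputable def initForm (N : ℕ) (q : (LaurentSeries ℂ)[X]) (γ : WithTop ℤ) : ℂ[X] :=
  initPoly (leadSet (coeffOrd N q) γ) (coeffAc N q)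

variable {q : (LaurentSeries ℂ)[X]} (hq : q.natDegree ≤ N)
include hq

theorem eval_eq_sum_fin (u : LaurentSeries ℂ) :
    q.eval u = ∑ i : Fin (N + 1), q.coeff i * u ^ (i : ℕ) := by
  rw [eval_eq_sum_range' (Nat.lt_succ_of_le hq), Finset.sum_range]

theorem eval_eq_zero_of_minOrd_eq_top {u : LaurentSeries ℂ}
    (h : minOrd (coeffOrd N q) (ord u) = ⊤) : q.eval u = 0 := by
  rw [eval_eq_sum_fin hq]
  refine Finset.sum_eq_zero fun i _ => ?_
  have := minOrd_le (coeffOrd N q) (ord u) i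
  rw [h, top_le_iff, coeffOrd, ← ord_pow, ← ord_mul] at this
  simpa [ord] using this

omit hq in
theorem initForm_eval_of_minOrd_eq_top {u : LaurentSeries ℂ}
    (h : minOrd (coeffOrd N q) (ord u) = ⊤) : (initForm N q (ord u)).eval (ac u) = 0 := by
  rw [initForm, initPoly, eval_finsetSum]
  refine Finset.sum_eq_zero fun i _ => ?_
  have := minOrd_le (coeffOrd N q) (ord u) i
  rw [h, top_le_iff, coeffOrd, ← ord_pow, ← ord_mul, ← ac_eq_zero_iff_ord_eq_top, ac_mul,
    ac_pow] at this
  rw [eval_monomial, coeffAc, this]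

theorem coeff_eval_eq {u : LaurentSeries ℂ} {m : ℤ} (hm : minOrd (coeffOrd N q) (ord u) = m) :
    (m : WithTop ℤ) ≤ ord (q.eval u) ∧
      (q.eval u).coeff m = (initForm N q (ord u)).eval (ac u) := by
  have hterm : ∀ i : Fin (N + 1), ord (q.coeff i * u ^ (i : ℕ)) =
      coeffOrd N q i + (i : ℕ) • ord u := fun i => by rw [ord_mul, ord_pow, coeffOrd]
  have hle : ∀ i : Fin (N + 1), (m : WithTop ℤ) ≤ ord (q.coeff i * u ^ (i : ℕ)) := fun i => by
    rw [hterm, ← hm]; exact minOrd_le _ _ i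
  rw [eval_eq_sum_fin hq]
  refine ⟨le_ord_sum _ _ fun i _ => hle i, ?_⟩
  rw [HahnSeries.coeff_sum, initForm, initPoly, eval_finsetSum, leadSet, Finset.sum_filter]
  refine Finset.sum_congr rfl fun i _ => ?_
  rw [coeff_of_le_ord (hle i), hterm, hm, ac_mul, ac_pow, eval_monomial, coeffAc]

/-- If the leading terms of `q.eval u` do not cancel, they determine its order and angular
component. -/
theorem ord_ac_eval {u : LaurentSeries ℂ}
    (h : minOrd (coeffOrd N q) (ord u) = ⊤ ∨ (initForm N q (ord u)).eval (ac u) ≠ 0) :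
    ord (q.eval u) = minOrd (coeffOrd N q) (ord u) ∧
      ac (q.eval u) = (initForm N q (ord u)).eval (ac u) := by
  by_cases hm : minOrd (coeffOrd N q) (ord u) = ⊤
  · rw [initForm_eval_of_minOrd_eq_top hm, eval_eq_zero_of_minOrd_eq_top hq hm, hm]
    simp [ord, ac]
  · have h' := h.resolve_left hm
    obtain ⟨m, hm⟩ := WithTop.ne_top_iff_exists.1 hm
    obtain ⟨h1, h2⟩ := coeff_eval_eq hq hm.symm
    rw [← h2] at h' ⊢
    rw [← hm]
    exact ord_eq_and_ac_eq h1 h'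

theorem initForm_eval_of_eval_eq_zero {u : LaurentSeries ℂ} (h : q.eval u = 0) :
    (initForm N q (ord u)).eval (ac u) = 0 := by
  by_contra h0
  have := (ord_ac_eval hq (Or.inr h0)).2
  rw [h] at this
  exact h0 (this ▸ by simp [ac])

end initialForm

instance : HenselianLocalRing (PowerSeries ℂ) where
  is_henselian f hf a₀ h₁ h₂ := by
    have : IsAdicComplete (Ideal.span {(PowerSeries.X : PowerSeries ℂ)}) (PowerSeries ℂ) :=
      inferInstance
    have hs := PowerSeries.maximalIdeal_eq_span_X (k := ℂ)
    have hI : HenselianRing (PowerSeries ℂ) (Ideal.span {(PowerSeries.X : PowerSeries ℂ)}) :=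
      inferInstance
    rw [hs] at h₁ ⊢
    exact hI.is_henselian f hf a₀ h₁ (h₂.map _)

theorem mem_maximalIdeal_powerSeries {x : PowerSeries ℂ} :
    x ∈ IsLocalRing.maximalIdeal (PowerSeries ℂ) ↔ PowerSeries.constantCoeff x = 0 := by
  rw [PowerSeries.maximalIdeal_eq_span_X, Ideal.mem_span_singleton, PowerSeries.X_dvd_iff]

theorem isUnit_powerSeries {x : PowerSeries ℂ} :
    IsUnit x ↔ PowerSeries.constantCoeff x ≠ 0 := by
  rw [PowerSeries.isUnit_iff_constantCoeff, isUnit_iff_ne_zero]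

/-- Hensel's lemma at the origin, for polynomials that need not be monic. -/
theorem exists_root_of_coeff_one (T : (PowerSeries ℂ)[X])
    (h0 : PowerSeries.constantCoeff (T.coeff 0) = 0)
    (h1 : PowerSeries.constantCoeff (T.coeff 1) ≠ 0) :
    ∃ w, T.eval w = 0 ∧ PowerSeries.constantCoeff w = 0 := by
  obtain ⟨d, hd⟩ : ∃ d, T.natDegree = d + 1 := by
    refine Nat.exists_eq_succ_of_ne_zero fun h => h1 ?_
    rw [coeff_eq_zero_of_natDegree_lt (by omega), map_zero]
  let M : (PowerSeries ℂ)[X] := X ^ (d + 1) +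
    ∑ i ∈ Finset.range (d + 1), C (T.coeff (i + 1) * T.coeff 0 ^ i) * X ^ (d - i)
  have hM : M.Monic := by
    refine monic_X_pow_add ?_
    refine (degree_sum_le _ _).trans_lt ?_
    rw [Finset.sup_lt_iff (WithBot.bot_lt_coe _)]
    intro i _
    refine (degree_C_mul_X_pow_le _ _).trans_lt ?_
    exact_mod_cast (by omega : d - i < d + 1)
  have hmap : M.map (PowerSeries.constantCoeff (R := ℂ)) =
      X ^ (d + 1) + C (PowerSeries.constantCoeff (T.coeff 1)) * X ^ d := by
    simp only [M, Polynomial.map_add, Polynomial.map_pow, map_X, Polynomial.map_sum,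
      Polynomial.map_mul, map_C, map_mul, map_pow, h0]
    rw [Finset.sum_eq_single 0]
    · simp
    · intro i _ hi; simp [hi]
    · simp
  have hc : PowerSeries.constantCoeff (M.eval (-T.coeff 1)) = 0 := by
    rw [← eval₂_hom, ← eval_map, hmap]
    simp
    ring
  have hc' : PowerSeries.constantCoeff ((derivative M).eval (-T.coeff 1)) =
      (-PowerSeries.constantCoeff (T.coeff 1)) ^ d := by
    rw [← eval₂_hom, ← eval_map, ← derivative_map, hmap]
    rcases d with _ | d
    · simp
    · simp
      ring
  obtain ⟨s, hs, hsT⟩ := HenselianLocalRing.is_henselian M hM (-T.coeff 1)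
    (mem_maximalIdeal_powerSeries.2 hc)
    (by rw [isUnit_powerSeries, hc']; exact pow_ne_zero _ (neg_ne_zero.2 h1))
  have hsc : PowerSeries.constantCoeff s ≠ 0 := by
    rw [mem_maximalIdeal_powerSeries, map_sub, map_neg, sub_neg_eq_add] at hsT
    rw [eq_neg_of_add_eq_zero_left hsT]
    exact neg_ne_zero.2 h1
  obtain ⟨s', rfl⟩ := isUnit_powerSeries.2 hsc
  refine ⟨T.coeff 0 * ↑s'⁻¹, ?_, by rw [map_mul, h0, zero_mul]⟩
  have key : (s' : PowerSeries ℂ) ^ (d + 1) * T.eval (T.coeff 0 * ↑s'⁻¹) =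
      T.coeff 0 * M.eval ↑s' := by
    rw [eval_eq_sum_range, hd, Finset.sum_range_succ', mul_add, Finset.mul_sum]
    simp only [M, eval_add, eval_pow, eval_X, eval_finsetSum, eval_mul, eval_C]
    rw [mul_add, Finset.mul_sum, add_comm]
    congr 1
    · ring
    · refine Finset.sum_congr rfl fun i hi => ?_
      have hi' : d + 1 = (i + 1) + (d - i) := by have := Finset.mem_range.1 hi; omega
      have : (s' : PowerSeries ℂ) ^ (i + 1) * (↑s'⁻¹ : PowerSeries ℂ) ^ (i + 1) = 1 := by
        rw [← mul_pow, Units.mul_inv, one_pow]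
      rw [hi', pow_add, mul_pow]
      linear_combination (T.coeff (i + 1) * T.coeff 0 ^ (i + 1) * (s' : PowerSeries ℂ) ^ (d - i)) * this
  rw [hs, mul_zero] at key
  exact ((s'.isUnit.pow _).mul_right_eq_zero).1 key

/-- Hensel's lemma for polynomials that need not be monic. -/
theorem exists_root_of_simple_root (P : (PowerSeries ℂ)[X]) (z : ℂ)
    (h0 : (P.map (PowerSeries.constantCoeff (R := ℂ))).eval z = 0)
    (h1 : (derivative (P.map (PowerSeries.constantCoeff (R := ℂ)))).eval z ≠ 0) :
    ∃ w, P.eval w = 0 ∧ PowerSeries.constantCoeff w = z := by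
  have hz : z = PowerSeries.constantCoeff (PowerSeries.C z) := by simp
  rw [hz, eval_map, eval₂_hom] at h0
  rw [hz, derivative_map, eval_map, eval₂_hom] at h1
  obtain ⟨w, hw, hw0⟩ := exists_root_of_coeff_one (taylor (PowerSeries.C z) P)
    (by rw [taylor_coeff_zero, h0]) (by rwa [taylor_coeff_one])
  rw [taylor_eval] at hw
  exact ⟨_, hw, by simp [hw0]⟩

theorem eval_hasseDeriv {R : Type*} [CommRing R] {q : R[X]} {N : ℕ} (hq : q.natDegree ≤ N)
    (j : ℕ) (x : R) :
    (hasseDeriv j q).eval x =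
      ∑ i ∈ Finset.range (N + 1), (i.choose j : R) * q.coeff i * x ^ (i - j) := by
  rw [hasseDeriv_apply, sum_over_range' _ (by simp) _ (Nat.lt_succ_of_le hq), eval_finsetSum]
  simp only [eval_monomial]

theorem map_hasseDeriv {R S : Type*} [CommRing R] [CommRing S] (φ : R →+* S) (j : ℕ) (q : R[X]) :
    (hasseDeriv j q).map φ = hasseDeriv j (q.map φ) := by
  ext n
  simp [hasseDeriv_coeff]

theorem exists_powerSeries_coe {x : LaurentSeries ℂ} (hx : (0 : ℤ) ≤ ord x) :
    ∃ p : PowerSeries ℂ, HahnSeries.ofPowerSeries ℤ ℂ p = x ∧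
      PowerSeries.constantCoeff p = x.coeff 0 := by
  refine ⟨PowerSeries.mk fun n => x.coeff n, ?_, by simp⟩
  ext i
  rw [PowerSeries.coeff_coe]
  split_ifs with hi
  · exact (le_ord_iff.1 hx i hi).symm
  · rw [PowerSeries.coeff_mk, Int.natAbs_of_nonneg (not_lt.1 hi)]

theorem le_ord_coe (p : PowerSeries ℂ) : (0 : ℤ) ≤ ord (HahnSeries.ofPowerSeries ℤ ℂ p) ∧
    (HahnSeries.ofPowerSeries ℤ ℂ p).coeff 0 = PowerSeries.constantCoeff p := by
  refine ⟨le_ord_iff.2 fun i hi => ?_, ?_⟩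
  · rw [PowerSeries.coeff_coe, if_pos hi]
  · rw [PowerSeries.coeff_coe]; simp

/-- Simple nonzero roots of derivatives of the initial form lift. -/
theorem exists_root_of_initForm {N : ℕ} {q : (LaurentSeries ℂ)[X]} (hq : q.natDegree ≤ N) (γ : ℤ)
    {z : ℂ} (hz : z ≠ 0) (j : ℕ) (h0 : (hasseDeriv j (initForm N q γ)).eval z = 0)
    (h1 : (derivative (hasseDeriv j (initForm N q γ))).eval z ≠ 0) :
    ∃ u : LaurentSeries ℂ, ord u = γ ∧ ac u = z ∧ (hasseDeriv j q).eval u = 0 := by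
  obtain ⟨s, hs, hs'⟩ := exists_ord_ac γ 1 (by simp)
  obtain ⟨m, hm⟩ : ∃ m : ℤ, (m : WithTop ℤ) = minOrd (coeffOrd N q) γ := by
    rw [← WithTop.ne_top_iff_exists]
    intro h
    rw [← hs] at h h1
    refine h1 ?_
    suffices initForm N q (ord s) = 0 by simp [this]
    rw [initForm, initPoly]
    refine Finset.sum_eq_zero fun i _ => ?_
    have := minOrd_le (coeffOrd N q) (ord s) i
    rw [h, top_le_iff, coeffOrd, ← ord_pow, ← ord_mul, ← ac_eq_zero_iff_ord_eq_top, ac_mul,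
      ac_pow, hs', one_pow, mul_one] at this
    rw [coeffAc, this, monomial_zero_right]
  obtain ⟨t, ht, ht'⟩ := exists_ord_ac (-m : ℤ) 1 (by simp)
  have ht0 : t ≠ 0 := by rintro rfl; exact WithTop.coe_ne_top (ht.symm.trans HahnSeries.orderTop_zero)
  have hs0 : s ≠ 0 := by rintro rfl; exact WithTop.coe_ne_top (hs.symm.trans HahnSeries.orderTop_zero)
  have hterm : ∀ i : Fin (N + 1), (0 : ℤ) ≤ ord (t * (q.coeff i * s ^ (i : ℕ))) := fun i => by
    have := minOrd_le (coeffOrd N q) γ i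
    rw [← hm] at this
    rw [ord_mul, ord_mul, ord_pow, ht, hs]
    calc ((0 : ℤ) : WithTop ℤ) = ((-m : ℤ) : WithTop ℤ) + m := by norm_cast; simp
      _ ≤ _ := by gcongr; exact this
  choose p hp hp' using fun i => exists_powerSeries_coe (hterm i)
  let P : (PowerSeries ℂ)[X] := ∑ i : Fin (N + 1), monomial (i : ℕ) (p i)
  have hPc : ∀ i : Fin (N + 1), P.coeff i = p i := fun i => by
    simp only [P, finsetSum_coeff, coeff_monomial, Fin.val_inj]
    simp
  have hPN : P.natDegree ≤ N :=
    natDegree_sum_le_of_forall_le _ _ fun i _ =>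
      (natDegree_monomial_le _).trans (Nat.lt_succ_iff.1 i.2)
  have hPr : P.map (PowerSeries.constantCoeff (R := ℂ)) = initForm N q γ := by
    simp only [P, Polynomial.map_sum, map_monomial, initForm, initPoly, leadSet]
    rw [Finset.sum_filter]
    refine Finset.sum_congr rfl fun i _ => ?_
    rw [hp', coeff_of_le_ord (hterm i), ac_mul, ac_mul, ac_pow, ht', hs', one_pow, mul_one,
      one_mul, ord_mul, ord_mul, ord_pow, ht, hs]
    have : ((-m : ℤ) : WithTop ℤ) + (ord (q.coeff i) + (i : ℕ) • (γ : WithTop ℤ)) = (0 : ℤ) ↔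
        coeffOrd N q i + (i : ℕ) • (γ : WithTop ℤ) = minOrd (coeffOrd N q) γ := by
      rw [← hm, coeffOrd]
      generalize ord (q.coeff i) + (i : ℕ) • (γ : WithTop ℤ) = x
      induction x with
      | top => simp
      | coe x => norm_cast; constructor <;> intro h <;> linarith
    simp only [this]
    split_ifs
    · rfl
    · simp
  rw [← hPr, ← map_hasseDeriv] at h0 h1
  obtain ⟨w, hw, hwz⟩ := exists_root_of_simple_root _ z h0 h1
  obtain ⟨hw1, hw2⟩ := le_ord_coe w
  obtain ⟨hw3, hw4⟩ := ord_eq_and_ac_eq hw1 (by rw [hw2, hwz]; exact hz)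
  refine ⟨s * HahnSeries.ofPowerSeries ℤ ℂ w, ?_, ?_, ?_⟩
  · rw [ord_mul, hs, hw3]; simp
  · rw [ac_mul, hs', hw4, hw2, hwz, one_mul]
  · have key := congrArg (HahnSeries.ofPowerSeries ℤ ℂ) hw
    rw [eval_hasseDeriv hPN, map_zero, map_sum] at key
    have : t * s ^ j * (hasseDeriv j q).eval (s * HahnSeries.ofPowerSeries ℤ ℂ w) = 0 := by
      rw [← key, eval_hasseDeriv hq, Finset.mul_sum]
      refine Finset.sum_congr rfl fun i hi => ?_
      have hi' := Finset.mem_range.1 hi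
      rw [map_mul, map_mul, map_natCast, map_pow, hPc ⟨i, hi'⟩, hp]
      by_cases hij : j ≤ i
      · obtain ⟨l, rfl⟩ := Nat.exists_eq_add_of_le hij
        rw [Nat.add_sub_cancel_left]
        ring
      · simp [Nat.choose_eq_zero_of_lt (not_le.1 hij)]
    exact (mul_eq_zero.1 this).resolve_left (mul_ne_zero ht0 (pow_ne_zero _ hs0))

instance : CharZero (LaurentSeries ℂ) :=
  charZero_of_injective_ringHom (f := HahnSeries.C (Γ := ℤ) (R := ℂ)) HahnSeries.C_injective

theorem ac_coeff_ne_zero_of_mem_leadSet {N : ℕ} {q : (LaurentSeries ℂ)[X]} {γ : WithTop ℤ}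
    (h : minOrd (coeffOrd N q) γ ≠ ⊤) {i : Fin (N + 1)} (hi : i ∈ leadSet (coeffOrd N q) γ) :
    (initForm N q γ).coeff i ≠ 0 := by
  rw [initForm, initPoly_coeff, if_pos hi, coeffAc, Ne, ac_eq_zero_iff_ord_eq_top]
  intro h'
  rw [mem_leadSet, coeffOrd, h', top_add] at hi
  exact h hi.symm

theorem initForm_coeff_eq_zero {N : ℕ} {q : (LaurentSeries ℂ)[X]} (γ : WithTop ℤ) {i : ℕ}
    (hi : q.coeff i = 0) : (initForm N q γ).coeff i = 0 := by
  by_cases hN : N < i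
  · exact initPoly_coeff_of_lt _ _ hN
  · have := initPoly_coeff (leadSet (coeffOrd N q) γ) (coeffAc N q) ⟨i, by omega⟩
    rw [initForm, this, coeffAc, hi]
    simp [ac]

theorem eval_hasseDeriv_taylor {R : Type*} [CommRing R] (q : R[X]) (j : ℕ) (b u : R) :
    (hasseDeriv j (taylor b q)).eval u = (hasseDeriv j q).eval (u + b) := by
  rw [← taylor_coeff, taylor_taylor, taylor_coeff]

/-- If the initial form at `b'` degenerates at `b`, then some derivative has a root closer
to `b`. -/
theorem exists_closer_root {N : ℕ} {P : (LaurentSeries ℂ)[X]} (hP : P.natDegree ≤ N)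
    {b b' : LaurentSeries ℂ} (hm : minOrd (coeffOrd N (taylor b' P)) (ord (b - b')) ≠ ⊤) (j₀ : ℕ)
    (h : ∀ i ≤ j₀,
      (hasseDeriv i (initForm N (taylor b' P) (ord (b - b')))).eval (ac (b - b')) = 0) :
    ∃ j ≥ j₀, ∃ b'', hasseDeriv j P ≠ 0 ∧ (hasseDeriv j P).eval b'' = 0 ∧
      ord (b - b') < ord (b - b'') := by
  classical
  set u := b - b' with hu
  set r := initForm N (taylor b' P) (ord u) with hr
  obtain ⟨i, hi⟩ := exists_mem_leadSet (coeffOrd N (taylor b' P)) (ord u)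
  have hri := ac_coeff_ne_zero_of_mem_leadSet hm hi
  have hne : ∃ n, (hasseDeriv n r).eval (ac u) ≠ 0 := by
    by_contra! h'
    exact hri (by rw [← hr, eq_zero_of_hasseDeriv_eq_zero r _ h', coeff_zero])
  have hu0 : u ≠ 0 := by
    intro hu0
    have h1 := h 0 (Nat.zero_le _)
    rw [hasseDeriv_zero', hu0, show ac (0 : LaurentSeries ℂ) = 0 by simp [ac],
      ← coeff_zero_eq_eval_zero] at h1
    have hi0 : (i : ℕ) = 0 := by
      by_contra hi0
      rw [mem_leadSet, hu0, show ord (0 : LaurentSeries ℂ) = ⊤ from HahnSeries.orderTop_zero,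
        ← Nat.succ_pred_eq_of_pos (Nat.pos_of_ne_zero hi0), succ_nsmul, add_top, add_top] at hi
      refine hm ?_
      rw [hi, hu0]
      exact congrArg _ HahnSeries.orderTop_zero
    rw [hi0] at hri
    exact hri h1
  have hγ : ord u ≠ ⊤ := fun h' => hu0 (by simpa [ord] using h')
  have hz : ac u ≠ 0 := by rwa [Ne, ac_eq_zero_iff_ord_eq_top]
  obtain ⟨γ, hγ⟩ := WithTop.ne_top_iff_exists.1 hγ
  have hn := Nat.find_spec hne
  have hmin := fun k hk => Nat.find_min hne (m := k) hk
  generalize Nat.find hne = n at hn hmin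
  have hj₀n : j₀ < n := by
    by_contra! h'
    exact hn (h n h')
  obtain ⟨j, rfl⟩ : ∃ j, n = j + 1 := ⟨n - 1, by omega⟩
  have h1 : (derivative (hasseDeriv j r)).eval (ac u) ≠ 0 := by
    have hc : derivative (hasseDeriv j r) = (1 + j).choose 1 • hasseDeriv (1 + j) r := by
      have := congrArg (fun l => l r) (hasseDeriv_comp (R := ℂ) 1 j)
      rw [hasseDeriv_one] at this
      exact this
    rw [hc, eval_smul, Nat.choose_one_right, nsmul_eq_mul, add_comm 1 j]
    exact mul_ne_zero (by exact_mod_cast Nat.succ_ne_zero j) hn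
  have h0 : (hasseDeriv j r).eval (ac u) = 0 := by
    by_contra h'
    exact hmin j (Nat.lt_succ_self j) h'
  have hj : hasseDeriv j P ≠ 0 := by
    intro hj
    have hT : hasseDeriv j (taylor b' P) = 0 := by
      refine Polynomial.funext fun x => ?_
      rw [eval_hasseDeriv_taylor, hj, eval_zero, eval_zero]
    refine h1 ?_
    suffices hasseDeriv j r = 0 by simp [this]
    ext n
    have := congrArg (fun p => p.coeff n) hT
    simp only [hasseDeriv_coeff, coeff_zero, mul_eq_zero, Nat.cast_eq_zero] at this ⊢
    refine Or.inr (initForm_coeff_eq_zero _ (this.resolve_left ?_))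
    exact (Nat.choose_pos (Nat.le_add_left j n)).ne'
  rw [hr, ← hγ] at h0 h1
  obtain ⟨u', hu', hu'z, hu'0⟩ :=
    exists_root_of_initForm (by rwa [natDegree_taylor]) γ hz j h0 h1
  rw [eval_hasseDeriv_taylor] at hu'0
  refine ⟨j, Nat.lt_succ_iff.1 hj₀n, u' + b', hj, hu'0, ?_⟩
  rw [← sub_sub, sub_right_comm, ← hu, ← hγ]
  exact lt_ord_sub hγ.symm hu' hu'z.symm

/-- Around every root `b` of `q` there is a center, chosen among finitely many points, with respect
to which `b` is a simple root of the initial form of `q`, and no root of the initial forms of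
the `p k`. -/
theorem exists_center {κ : Type*} [Finite κ] {N : ℕ} (p : κ → (LaurentSeries ℂ)[X])
    (hp : ∀ k, (p k).natDegree ≤ N) {q : (LaurentSeries ℂ)[X]} (hq : q.natDegree ≤ N)
    {b : LaurentSeries ℂ} (hb : q.eval b = 0) :
    ∃ b', (b' = 0 ∨ (∃ k, ∃ j, hasseDeriv j (p k) ≠ 0 ∧ (hasseDeriv j (p k)).eval b' = 0) ∨
        ∃ j ≥ 1, hasseDeriv j q ≠ 0 ∧ (hasseDeriv j q).eval b' = 0) ∧
      (∀ k, minOrd (coeffOrd N (taylor b' (p k))) (ord (b - b')) = ⊤ ∨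
        (initForm N (taylor b' (p k)) (ord (b - b'))).eval (ac (b - b')) ≠ 0) ∧
      (minOrd (coeffOrd N (taylor b' q)) (ord (b - b')) = ⊤ ∨
        ((initForm N (taylor b' q) (ord (b - b'))).eval (ac (b - b')) = 0 ∧
          (derivative (initForm N (taylor b' q) (ord (b - b')))).eval (ac (b - b')) ≠ 0)) := by
  set S : Set (LaurentSeries ℂ) := {b' | b' = 0 ∨
    (∃ k, ∃ j, hasseDeriv j (p k) ≠ 0 ∧ (hasseDeriv j (p k)).eval b' = 0) ∨
        ∃ j ≥ 1, hasseDeriv j q ≠ 0 ∧ (hasseDeriv j q).eval b' = 0} with hS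
  have hfin1 : ∀ P : (LaurentSeries ℂ)[X], {x | P ≠ 0 ∧ P.eval x = 0}.Finite := fun P => by
    classical
    by_cases hP : P = 0
    · simp [hP]
    · exact (P.roots.toFinset.finite_toSet).subset fun x hx => by simpa [hP] using hx.2
  have hfin2 : ∀ P : (LaurentSeries ℂ)[X],
      {x | ∃ j, hasseDeriv j P ≠ 0 ∧ (hasseDeriv j P).eval x = 0}.Finite := fun P => by
    refine ((Finset.range (P.natDegree + 1)).finite_toSet.biUnion
      fun j _ => hfin1 (hasseDeriv j P)).subset ?_
    rintro x ⟨j, hj, hx⟩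
    refine Set.mem_biUnion (x := j) ?_ ⟨hj, hx⟩
    by_contra h
    exact hj (hasseDeriv_eq_zero_of_lt_natDegree _ _ (by simpa using h))
  have hSfin : S.Finite := by
    refine ((Set.finite_singleton 0).union ((Set.finite_iUnion fun k => hfin2 (p k)).union
      (hfin2 q))).subset ?_
    rintro x (rfl | ⟨k, h⟩ | ⟨j, -, h⟩)
    · exact Or.inl rfl
    · exact Or.inr (Or.inl (Set.mem_iUnion.2 ⟨k, h⟩))
    · exact Or.inr (Or.inr ⟨j, h⟩)
  obtain ⟨b', hb'S, hmax⟩ := Set.exists_max_image S (fun x => ord (b - x)) hSfin ⟨0, Or.inl rfl⟩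
  refine ⟨b', hb'S, fun k => ?_, ?_⟩
  · by_contra! hbad
    obtain ⟨j, -, b'', hj, h0, hlt⟩ := exists_closer_root (hp k) hbad.1 0 (fun i hi => by
      rw [Nat.le_zero.1 hi, hasseDeriv_zero']; exact hbad.2)
    exact absurd hlt (hmax b'' (Or.inr (Or.inl ⟨k, j, hj, h0⟩))).not_gt
  · have h0 := initForm_eval_of_eval_eq_zero (N := N) (q := taylor b' q) (u := b - b')
      (by rwa [natDegree_taylor]) (by rw [taylor_eval, sub_add_cancel, hb])
    by_contra! hbad
    obtain ⟨j, hj1, b'', hj, h0, hlt⟩ := exists_closer_root hq hbad.1 1 (fun i hi => by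
      interval_cases i
      · rw [hasseDeriv_zero']; exact h0
      · rw [hasseDeriv_one']; exact hbad.2 h0)
    exact absurd hlt (hmax b'' (Or.inr (Or.inr ⟨j, hj1, hj, h0⟩))).not_gt

noncomputable instance : FirstOrder.Ring.CompatibleRing ℂ :=
  FirstOrder.Ring.compatibleRingOfRing ℂ

/-- A predicate on complex tuples which is definable without parameters in the field language. -/
def CDef {ι : Type*} (p : (ι → ℂ) → Prop) : Prop :=
  (∅ : Set ℂ).Definable Language.ring {y | p y}

/-- A complex function which is definable without parameters in the field language. -/
abbrev CDefFun {ι : Type*} (f : (ι → ℂ) → ℂ) : Prop :=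
  (∅ : Set ℂ).DefinableFun Language.ring f

section CDef

variable {ι κ : Type*}

theorem CDef.and {p q : (ι → ℂ) → Prop} (hp : CDef p) (hq : CDef q) : CDef fun y => p y ∧ q y :=
  Set.Definable.inter hp hq

theorem CDef.or {p q : (ι → ℂ) → Prop} (hp : CDef p) (hq : CDef q) : CDef fun y => p y ∨ q y :=
  Set.Definable.union hp hq

theorem CDef.not {p : (ι → ℂ) → Prop} (hp : CDef p) : CDef fun y => ¬ p y :=
  Set.Definable.compl hp

theorem CDef.const (p : Prop) : CDef fun _ : ι → ℂ => p := by
  by_cases hp : p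
  · simp [CDef, hp]
  · simp [CDef, hp]

theorem CDef.exists_fun [Finite κ] {p : (ι ⊕ κ → ℂ) → Prop} (hp : CDef p) :
    CDef fun y : ι → ℂ => ∃ w : κ → ℂ, p (Sum.elim y w) :=
  Set.Definable.exists_of_finite hp

theorem CDef.exists_finite [Finite κ] {p : κ → (ι → ℂ) → Prop} (hp : ∀ k, CDef (p k)) :
    CDef fun y => ∃ k, p k y := by
  have := Set.definable_iUnion_of_finite (f := fun k => {y | p k y}) hp
  rwa [← Set.ofPred_exists] at this

theorem CDef.forall_finite [Finite κ] {p : κ → (ι → ℂ) → Prop} (hp : ∀ k, CDef (p k)) :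
    CDef fun y => ∀ k, p k y := by
  have := Set.definable_iInter_of_finite (f := fun k => {y | p k y}) hp
  rwa [← Set.ofPred_forall] at this

theorem CDef.preimage [Finite κ] {p : (κ → ℂ) → Prop} (hp : CDef p) {F : (ι → ℂ) → κ → ℂ}
    (hF : ∀ k, CDefFun fun y => F y k) : CDef fun y => p (F y) :=
  Set.Definable.preimage_map (F := F) hF hp

theorem CDefFun.eq {f g : (ι → ℂ) → ℂ} (hf : CDefFun f) (hg : CDefFun g) :
    CDef fun y => f y = g y := Set.DefinableFun.ofPred_eq hf hg

theorem CDefFun.var (i : ι) : CDefFun fun y : ι → ℂ => y i := Set.DefinableFun.proj _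

theorem CDefFun.add {f g : (ι → ℂ) → ℂ} (hf : CDefFun f) (hg : CDefFun g) :
    CDefFun fun y => f y + g y := by
  have := Set.DefinableFun.comp (g := fun y => ![f y, g y]) (fun i => by fin_cases i <;> assumption)
    (Set.DefinableFun.fun_symbol (M := ℂ) (FirstOrder.Ring.addFunc))
  simpa using! this

theorem CDefFun.mul {f g : (ι → ℂ) → ℂ} (hf : CDefFun f) (hg : CDefFun g) :
    CDefFun fun y => f y * g y := by
  have := Set.DefinableFun.comp (g := fun y => ![f y, g y]) (fun i => by fin_cases i <;> assumption)
    (Set.DefinableFun.fun_symbol (M := ℂ) (FirstOrder.Ring.mulFunc))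
  simpa using! this

theorem CDefFun.zero : CDefFun fun _ : ι → ℂ => 0 := by
  have := Set.DefinableFun.comp (g := fun (_ : ι → ℂ) => ![]) (fun i => i.elim0)
    (Set.DefinableFun.fun_symbol (M := ℂ) (FirstOrder.Ring.zeroFunc))
  simpa using! this

theorem CDefFun.one : CDefFun fun _ : ι → ℂ => 1 := by
  have := Set.DefinableFun.comp (g := fun (_ : ι → ℂ) => ![]) (fun i => i.elim0)
    (Set.DefinableFun.fun_symbol (M := ℂ) (FirstOrder.Ring.oneFunc))
  simpa using! this

theorem CDefFun.natCast (n : ℕ) : CDefFun fun _ : ι → ℂ => (n : ℂ) := by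
  induction n with
  | zero => simpa using CDefFun.zero
  | succ n ih => simpa using ih.add CDefFun.one

theorem CDefFun.pow {f : (ι → ℂ) → ℂ} (hf : CDefFun f) (n : ℕ) : CDefFun fun y => f y ^ n := by
  induction n with
  | zero => simpa using CDefFun.one
  | succ n ih => simpa only [pow_succ] using ih.mul hf

theorem CDefFun.sum (s : Finset κ) {f : κ → (ι → ℂ) → ℂ} (hf : ∀ k, CDefFun (f k)) :
    CDefFun fun y => ∑ k ∈ s, f k y := by
  classical
  induction s using Finset.induction_on with
  | empty => simpa using CDefFun.zero
  | insert k s hk ih => simpa only [Finset.sum_insert hk] using (hf k).add ih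

end CDef

/-- A family of definable predicates on complex tuples with only finitely many members. -/
def Tame {Γ ι : Type*} (D : Γ → (ι → ℂ) → Prop) : Prop :=
  (Set.range D).Finite ∧ ∀ g, CDef (D g)

namespace Tame

variable {Γ Γ' ι κ : Type*} {D E : Γ → (ι → ℂ) → Prop}

theorem of_finite {T : Type*} [Finite T] (h : Γ → T) {P : T → (ι → ℂ) → Prop}
    (hP : ∀ t, CDef (P t)) : Tame fun g y => P (h g) y :=
  ⟨(Set.finite_range P).subset (Set.range_subset_iff.2 fun g => ⟨h g, rfl⟩), fun _ => hP _⟩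

theorem of_cdef {P : (ι → ℂ) → Prop} (hP : CDef P) : Tame fun (_ : Γ) y => P y :=
  of_finite (fun _ => ()) fun _ => hP

theorem const (p : Γ → Prop) : Tame fun g (_ : ι → ℂ) => p g :=
  of_finite p (P := fun t _ => t) CDef.const

theorem and (hD : Tame D) (hE : Tame E) : Tame fun g y => D g y ∧ E g y :=
  ⟨(hD.1.image2 (fun p q y => p y ∧ q y) hE.1).subset (Set.range_subset_iff.2 fun g =>
    ⟨D g, ⟨g, rfl⟩, E g, ⟨g, rfl⟩, rfl⟩), fun g => (hD.2 g).and (hE.2 g)⟩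

theorem or (hD : Tame D) (hE : Tame E) : Tame fun g y => D g y ∨ E g y :=
  ⟨(hD.1.image2 (fun p q y => p y ∨ q y) hE.1).subset (Set.range_subset_iff.2 fun g =>
    ⟨D g, ⟨g, rfl⟩, E g, ⟨g, rfl⟩, rfl⟩), fun g => (hD.2 g).or (hE.2 g)⟩

theorem not (hD : Tame D) : Tame fun g y => ¬ D g y :=
  ⟨(hD.1.image fun p y => ¬ p y).subset (Set.range_subset_iff.2 fun g => ⟨D g, ⟨g, rfl⟩, rfl⟩),
    fun g => (hD.2 g).not⟩

theorem forall_finite [Finite κ] {F : κ → Γ → (ι → ℂ) → Prop} (hF : ∀ k, Tame (F k)) :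
    Tame fun g y => ∀ k, F k g y := by
  refine ⟨((Set.Finite.pi' fun k => (hF k).1).image fun p y => ∀ k, p k y).subset
    (Set.range_subset_iff.2 fun g => ⟨fun k => F k g, fun k => ⟨g, rfl⟩, rfl⟩),
    fun g => CDef.forall_finite fun k => (hF k).2 g⟩

theorem comp (hD : Tame D) (h : Γ' → Γ) : Tame fun g y => D (h g) y :=
  ⟨hD.1.subset (Set.range_subset_iff.2 fun g => ⟨h g, rfl⟩), fun _ => hD.2 _⟩

theorem preimage [Finite ι] (hD : Tame D) {T : Type*} [Finite T] (h : Γ → T)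
    {F : T → (κ → ℂ) → ι → ℂ} (hF : ∀ t i, CDefFun fun y => F t y i) :
    Tame fun g y => D g (F (h g) y) := by
  refine ⟨(hD.1.image2 (fun p (t : T) y => p (F t y)) Set.finite_univ).subset
    (Set.range_subset_iff.2 fun g => ⟨D g, ⟨g, rfl⟩, h g, trivial, rfl⟩),
    fun g => (hD.2 g).preimage (hF _)⟩

theorem exists_fun [Finite κ] {D : Γ → (κ → ℂ) → (ι → ℂ) → Prop}
    (hD : Tame fun g (y : ι ⊕ κ → ℂ) => D g (y ∘ Sum.inr) (y ∘ Sum.inl)) :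
    Tame fun g y => ∃ w, D g w y := by
  refine ⟨(hD.1.image fun p y => ∃ w : κ → ℂ, p (Sum.elim y w)).subset
    (Set.range_subset_iff.2 fun g => ⟨_, ⟨g, rfl⟩, ?_⟩), fun g => ?_⟩
  · funext y
    simp
  · simpa using (hD.2 g).exists_fun

theorem exists_index {D : Γ → Γ' → (ι → ℂ) → Prop} (hD : Tame fun g : Γ × Γ' => D g.1 g.2) :
    Tame fun g y => ∃ γ, D g γ y := by
  have hfin : ∀ g, (Set.range (D g)).Finite := fun g =>
    hD.1.subset (Set.range_subset_iff.2 fun γ => ⟨(g, γ), rfl⟩)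
  refine ⟨(hD.1.finite_subsets.image fun s y => ∃ p ∈ s, p y).subset
    (Set.range_subset_iff.2 fun g => ⟨Set.range (D g), ?_, ?_⟩), fun g => ?_⟩
  · exact Set.range_subset_iff.2 fun γ => ⟨(g, γ), rfl⟩
  · funext y
    simp
  · have := (hfin g).to_subtype
    have h := CDef.exists_finite (κ := Set.range (D g)) (p := fun k => k.1) (by
      rintro ⟨_, γ, rfl⟩; exact hD.2 (g, γ))
    convert h using 2
    simp

end Tame

/-- A predicate on `K`-points of `A` that depends, in a tame way, only on the orders and angular
components of finitely many elements of `A`. -/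
def QPred {A : Type*} [CommRing A] (p : (A →+* LaurentSeries ℂ) → Prop) : Prop :=
  ∃ (n : ℕ) (f : Fin n → A) (D : (Fin n → WithTop ℤ) → (Fin n → ℂ) → Prop), Tame D ∧
    ∀ ω, p ω ↔ D (fun i => ord (ω (f i))) (fun i => ac (ω (f i)))

namespace QPred

variable {A B : Type*} [CommRing A] [CommRing B] {p q : (A →+* LaurentSeries ℂ) → Prop}

theorem intro {κ : Type*} [Finite κ] (f : κ → A) {D : (κ → WithTop ℤ) → (κ → ℂ) → Prop}
    (hD : Tame D) (h : ∀ ω, p ω ↔ D (fun i => ord (ω (f i))) (fun i => ac (ω (f i)))) :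
    QPred p := by
  obtain ⟨n, ⟨e⟩⟩ := Finite.exists_equiv_fin κ
  refine ⟨n, f ∘ e.symm, fun g y => D (g ∘ e) (y ∘ e), ?_, fun ω => ?_⟩
  · exact (hD.comp fun g => g ∘ e).preimage (fun _ => ()) (F := fun _ y i => y (e i))
      fun _ i => CDefFun.var _
  · rw [h]
    simp [Function.comp_def]

theorem congr (hp : QPred p) (h : ∀ ω, q ω ↔ p ω) : QPred q := by
  rwa [funext fun ω => propext (h ω)]

theorem const (P : Prop) : QPred fun _ : A →+* LaurentSeries ℂ => P :=
  intro (κ := Empty) Empty.elim (Tame.const fun _ => P) fun _ => Iff.rfl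

theorem not (hp : QPred p) : QPred fun ω => ¬ p ω := by
  obtain ⟨n, f, D, hD, h⟩ := hp
  exact ⟨n, f, _, hD.not, fun ω => not_congr (h ω)⟩

theorem binary {op : Prop → Prop → Prop} (hp : QPred p) (hq : QPred q)
    (hop : ∀ {ι : Type} {D E : (ι → WithTop ℤ) → (ι → ℂ) → Prop}, Tame D → Tame E →
      Tame fun g y => op (D g y) (E g y)) : QPred fun ω => op (p ω) (q ω) := by
  obtain ⟨n, f, D, hD, h⟩ := hp
  obtain ⟨m, g, E, hE, h'⟩ := hq
  refine intro (Sum.elim f g) (D := fun γ y => op (D (γ ∘ Sum.inl) (y ∘ Sum.inl))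
    (E (γ ∘ Sum.inr) (y ∘ Sum.inr))) (hop ?_ ?_) fun ω => ?_
  · exact (hD.comp fun g => g ∘ Sum.inl).preimage (fun _ => ()) (F := fun _ y i => y (Sum.inl i))
      fun _ i => CDefFun.var _
  · exact (hE.comp fun g => g ∘ Sum.inr).preimage (fun _ => ()) (F := fun _ y i => y (Sum.inr i))
      fun _ i => CDefFun.var _
  · rw [h, h']
    rfl

theorem and (hp : QPred p) (hq : QPred q) : QPred fun ω => p ω ∧ q ω :=
  hp.binary hq Tame.and

theorem or (hp : QPred p) (hq : QPred q) : QPred fun ω => p ω ∨ q ω :=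
  hp.binary hq Tame.or

theorem exists_finite {κ : Type*} [Finite κ] {p : κ → (A →+* LaurentSeries ℂ) → Prop}
    (hp : ∀ k, QPred (p k)) : QPred fun ω => ∃ k, p k ω := by
  classical
  cases nonempty_fintype κ
  suffices ∀ s : Finset κ, QPred fun ω => ∃ k ∈ s, p k ω from
    (this Finset.univ).congr fun ω => by simp
  intro s
  induction s using Finset.induction_on with
  | empty => exact (const False).congr fun ω => by simp
  | insert k s _ ih => exact ((hp k).or ih).congr fun ω => by simp

theorem comap (hp : QPred p) (g : A →+* B) : QPred fun ω : B →+* LaurentSeries ℂ => p (ω.comp g) := by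
  obtain ⟨n, f, D, hD, h⟩ := hp
  exact ⟨n, g ∘ f, D, hD, fun ω => h _⟩

theorem eq_zero (a : A) : QPred fun ω => ω a = 0 :=
  intro (κ := Unit) (fun _ => a) (Tame.const fun g => g () = ⊤) fun ω => by simp [ord]

end QPred

theorem CDefFun.initPoly_eval {ι : Type*} {N : ℕ} (I : Finset (Fin (N + 1)))
    {a : Fin (N + 1) → (ι → ℂ) → ℂ} {z : (ι → ℂ) → ℂ} (ha : ∀ i, CDefFun (a i)) (hz : CDefFun z) :
    CDefFun fun y => (initPoly I fun i => a i y).eval (z y) := by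
  simp only [initPoly, eval_finsetSum, eval_monomial]
  exact CDefFun.sum _ fun i => (ha i).mul (hz.pow _)

theorem CDefFun.derivative_initPoly_eval {ι : Type*} {N : ℕ} (I : Finset (Fin (N + 1)))
    {a : Fin (N + 1) → (ι → ℂ) → ℂ} {z : (ι → ℂ) → ℂ} (ha : ∀ i, CDefFun (a i)) (hz : CDefFun z) :
    CDefFun fun y => (derivative (initPoly I fun i => a i y)).eval (z y) := by
  simp only [initPoly, derivative_sum, derivative_monomial, eval_finsetSum, eval_monomial]
  exact CDefFun.sum _ fun i => ((ha i).mul (CDefFun.natCast _)).mul (hz.pow _)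

/-- Simple roots of the initial form lift to roots. -/
theorem exists_root_of_ord_ac {N : ℕ} {q : (LaurentSeries ℂ)[X]} (hq : q.natDegree ≤ N)
    {γ : WithTop ℤ} {z : ℂ} (hzγ : z = 0 ↔ γ = ⊤)
    (h : minOrd (coeffOrd N q) γ = ⊤ ∨
      ((initForm N q γ).eval z = 0 ∧ (derivative (initForm N q γ)).eval z ≠ 0)) :
    ∃ u, ord u = γ ∧ ac u = z ∧ q.eval u = 0 := by
  by_cases hm : minOrd (coeffOrd N q) γ = ⊤
  · obtain ⟨u, hu, hu'⟩ := exists_ord_ac γ z hzγ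
    exact ⟨u, hu, hu', eval_eq_zero_of_minOrd_eq_top hq (by rwa [hu])⟩
  · obtain ⟨h0, h1⟩ := h.resolve_left hm
    have hz : z ≠ 0 := by
      rintro rfl
      obtain rfl : γ = ⊤ := hzγ.1 rfl
      rw [← coeff_zero_eq_eval_zero, coeff_derivative] at h1
      refine left_ne_zero_of_mul h1 ?_
      by_cases hN : N < 0 + 1
      · exact initPoly_coeff_of_lt _ _ hN
      · have := initPoly_coeff (leadSet (coeffOrd N q) ⊤) (coeffAc N q) ⟨0 + 1, by omega⟩
        rw [initForm, this, if_neg]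
        rw [mem_leadSet]
        intro h
        refine hm ?_
        rw [← h]
        simp
    obtain ⟨γ, rfl⟩ := WithTop.ne_top_iff_exists.1 (fun h => hz (hzγ.2 h))
    obtain ⟨u, hu, hu', hu0⟩ := exists_root_of_initForm hq γ hz 0 (by rwa [hasseDeriv_zero'])
      (by rwa [hasseDeriv_zero'])
    exact ⟨u, hu, hu', by rwa [hasseDeriv_zero'] at hu0⟩

/-- Quantification over the roots of `h` preserves tame predicates. -/
def Elim {A : Type*} [CommRing A] (h : A[X]) : Prop :=
  ∀ p : (A[X] →+* LaurentSeries ℂ) → Prop, QPred p →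
    QPred fun ω : A →+* LaurentSeries ℂ =>
      h.map ω ≠ 0 ∧ ∃ b, h.eval₂ ω b = 0 ∧ p (eval₂RingHom ω b)

/-- The condition, on the orders `g` and angular components `y` of the Taylor coefficients at some
center, for the existence of a point whose order and angular component relative to that center
make the polynomials indexed by `some k` satisfy `D`, and such that the one indexed by `none`
has a root there. -/
def CenterCond {κ : Type*} {N : ℕ} (D : (κ → WithTop ℤ) → (κ → ℂ) → Prop)
    (g : Option κ × Fin (N + 1) → WithTop ℤ) (y : Option κ × Fin (N + 1) → ℂ) : Prop :=
  ∃ (γ : WithTop ℤ) (z : ℂ), (z = 0 ↔ γ = ⊤) ∧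
    (∀ k, minOrd (fun i => g (some k, i)) γ = ⊤ ∨
      (initPoly (leadSet (fun i => g (some k, i)) γ) fun i => y (some k, i)).eval z ≠ 0) ∧
    (minOrd (fun i => g (none, i)) γ = ⊤ ∨
      ((initPoly (leadSet (fun i => g (none, i)) γ) fun i => y (none, i)).eval z = 0 ∧
        (derivative
          (initPoly (leadSet (fun i => g (none, i)) γ) fun i => y (none, i))).eval z ≠ 0)) ∧
    D (fun k => minOrd (fun i => g (some k, i)) γ)
      (fun k => (initPoly (leadSet (fun i => g (some k, i)) γ) fun i => y (some k, i)).eval z)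

theorem tame_centerCond {κ : Type*} [Finite κ] {N : ℕ}
    {D : (κ → WithTop ℤ) → (κ → ℂ) → Prop} (hD : Tame D) :
    Tame (CenterCond (N := N) D) := by
  refine Tame.exists_index (D := fun (g : Option κ × Fin (N + 1) → WithTop ℤ) γ y => ∃ z : ℂ, _) ?_
  have hform : ∀ (k : Option κ) (I : Finset (Fin (N + 1))),
      CDefFun fun y : (Option κ × Fin (N + 1)) ⊕ Unit → ℂ =>
        (initPoly I fun i => y (Sum.inl (k, i))).eval (y (Sum.inr ())) := fun k I =>
    CDefFun.initPoly_eval I (fun i => CDefFun.var _) (CDefFun.var _)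
  have hform' : ∀ (k : Option κ) (I : Finset (Fin (N + 1))),
      CDefFun fun y : (Option κ × Fin (N + 1)) ⊕ Unit → ℂ =>
        (derivative (initPoly I fun i => y (Sum.inl (k, i)))).eval (y (Sum.inr ())) := fun k I =>
    CDefFun.derivative_initPoly_eval I (fun i => CDefFun.var _) (CDefFun.var _)
  let Γ := (Option κ × Fin (N + 1) → WithTop ℤ) × WithTop ℤ
  let lead : Option κ → Γ → Finset (Fin (N + 1)) := fun k g => leadSet (fun i => g.1 (k, i)) g.2
  have key : Tame fun (g : Γ) (y : (Option κ × Fin (N + 1)) ⊕ Unit → ℂ) =>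
      (y (Sum.inr ()) = 0 ↔ g.2 = ⊤) ∧
      (∀ k, minOrd (fun i => g.1 (some k, i)) g.2 = ⊤ ∨
        ¬ (initPoly (lead (some k) g) fun i => y (Sum.inl (some k, i))).eval (y (Sum.inr ())) = 0) ∧
      (minOrd (fun i => g.1 (none, i)) g.2 = ⊤ ∨
        ((initPoly (lead none g) fun i => y (Sum.inl (none, i))).eval (y (Sum.inr ())) = 0 ∧
          ¬ (derivative
            (initPoly (lead none g) fun i => y (Sum.inl (none, i)))).eval (y (Sum.inr ())) = 0)) ∧
      D (fun k => minOrd (fun i => g.1 (some k, i)) g.2)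
        (fun k => (initPoly (lead (some k) g) fun i => y (Sum.inl (some k, i))).eval
          (y (Sum.inr ()))) := by
    refine Tame.and ?_ (Tame.and ?_ (Tame.and ?_ ?_))
    · have h0 : CDef fun y : (Option κ × Fin (N + 1)) ⊕ Unit → ℂ => y (Sum.inr ()) = 0 :=
        (CDefFun.var _).eq CDefFun.zero
      refine Tame.of_finite (fun g : Γ => g.2 = ⊤) (P := fun P y => y (Sum.inr ()) = 0 ↔ P)
        fun P => ?_
      by_cases hP : P
      · simpa [hP] using h0
      · simpa [hP] using h0.not
    · refine Tame.forall_finite fun k => Tame.or (Tame.const _) ?_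
      exact Tame.of_finite (lead (some k)) (P := fun I y => ¬ (initPoly I fun i =>
        y (Sum.inl (some k, i))).eval (y (Sum.inr ())) = 0)
        fun I => ((hform _ I).eq CDefFun.zero).not
    · refine Tame.or (Tame.const _) (Tame.and ?_ ?_)
      · exact Tame.of_finite (lead none) (P := fun I y => (initPoly I fun i =>
          y (Sum.inl (none, i))).eval (y (Sum.inr ())) = 0)
          fun I => (hform _ I).eq CDefFun.zero
      · exact Tame.of_finite (lead none) (P := fun I y => ¬ (derivative (initPoly I fun i =>
          y (Sum.inl (none, i)))).eval (y (Sum.inr ())) = 0)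
          fun I => ((hform' _ I).eq CDefFun.zero).not
    · exact (hD.comp fun (g : Γ) k => minOrd (fun i => g.1 (some k, i)) g.2).preimage
        (fun g k => lead (some k) g)
        (F := fun I y k => (initPoly (I k) fun i => y (Sum.inl (some k, i))).eval (y (Sum.inr ())))
        fun I k => hform _ _
  have := Tame.exists_fun (κ := Unit) (D := fun (g : Γ) w y =>
      (w () = 0 ↔ g.2 = ⊤) ∧
      (∀ k, minOrd (fun i => g.1 (some k, i)) g.2 = ⊤ ∨
        ¬ (initPoly (lead (some k) g) fun i => y (some k, i)).eval (w ()) = 0) ∧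
      (minOrd (fun i => g.1 (none, i)) g.2 = ⊤ ∨
        ((initPoly (lead none g) fun i => y (none, i)).eval (w ()) = 0 ∧
          ¬ (derivative
            (initPoly (lead none g) fun i => y (none, i))).eval (w ()) = 0)) ∧
      D (fun k => minOrd (fun i => g.1 (some k, i)) g.2)
        (fun k => (initPoly (lead (some k) g) fun i => y (some k, i)).eval (w ()))) key
  convert! this using 3
  exact ⟨fun ⟨z, h⟩ => ⟨fun _ => z, h⟩, fun ⟨w, h⟩ => ⟨w (), h⟩⟩

theorem coeffOrd_taylor_map {A : Type*} [CommRing A] (N : ℕ) (f : A[X])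
    (ω : A →+* LaurentSeries ℂ) (b : LaurentSeries ℂ) :
    coeffOrd N (taylor b (f.map ω)) = fun i : Fin (N + 1) => ord (eval₂RingHom ω b (hasseDeriv i f)) := by
  funext i
  rw [coeffOrd, taylor_coeff, ← map_hasseDeriv, eval_map, coe_eval₂RingHom]

theorem coeffAc_taylor_map {A : Type*} [CommRing A] (N : ℕ) (f : A[X])
    (ω : A →+* LaurentSeries ℂ) (b : LaurentSeries ℂ) :
    coeffAc N (taylor b (f.map ω)) = fun i : Fin (N + 1) => ac (eval₂RingHom ω b (hasseDeriv i f)) := by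
  funext i
  rw [coeffAc, taylor_coeff, ← map_hasseDeriv, eval_map, coe_eval₂RingHom]

/-- Quantification over the roots of `q`, for a tame condition on polynomials `f k`, reduces to
quantification over the roots of the derivatives of `f k` and the proper derivatives of `q`. -/
theorem QPred.exists_root {A : Type*} [CommRing A] {κ : Type*} [Finite κ] (q : A[X])
    (f : κ → A[X]) {D : (κ → WithTop ℤ) → (κ → ℂ) → Prop} (hD : Tame D)
    (hf : ∀ k j, Elim (hasseDeriv j (f k))) (hq : ∀ j, Elim (hasseDeriv (j + 1) q)) :
    QPred fun ω : A →+* LaurentSeries ℂ => ∃ b, q.eval₂ ω b = 0 ∧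
      D (fun k => ord ((f k).eval₂ ω b)) (fun k => ac ((f k).eval₂ ω b)) := by
  cases nonempty_fintype κ
  obtain ⟨N, hfN, hqN⟩ : ∃ N, (∀ k, (f k).natDegree ≤ N) ∧ q.natDegree ≤ N :=
    ⟨(∑ k, (f k).natDegree) + q.natDegree,
      fun k => (Finset.single_le_sum (f := fun k => (f k).natDegree) (fun _ _ => Nat.zero_le _)
        (Finset.mem_univ k)).trans (Nat.le_add_right _ _), Nat.le_add_left _ _⟩
  let F : Option κ → A[X] := fun o => o.elim q f
  let ψ : (A[X] →+* LaurentSeries ℂ) → Prop := fun σ => CenterCond (N := N) D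
    (fun x => ord (σ (hasseDeriv x.2 (F x.1)))) (fun x => ac (σ (hasseDeriv x.2 (F x.1))))
  have hψ : QPred ψ := QPred.intro (κ := Option κ × Fin (N + 1))
    (fun x => hasseDeriv x.2 (F x.1)) (tame_centerCond hD) fun _ => Iff.rfl
  have hψ' : ∀ ω b', ψ (eval₂RingHom ω b') ↔ ∃ (γ : WithTop ℤ) (z : ℂ), (z = 0 ↔ γ = ⊤) ∧
      (∀ k, minOrd (coeffOrd N (taylor b' ((f k).map ω))) γ = ⊤ ∨
        (initForm N (taylor b' ((f k).map ω)) γ).eval z ≠ 0) ∧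
      (minOrd (coeffOrd N (taylor b' (q.map ω))) γ = ⊤ ∨
        ((initForm N (taylor b' (q.map ω)) γ).eval z = 0 ∧
          (derivative (initForm N (taylor b' (q.map ω)) γ)).eval z ≠ 0)) ∧
      D (fun k => minOrd (coeffOrd N (taylor b' ((f k).map ω))) γ)
        (fun k => (initForm N (taylor b' ((f k).map ω)) γ).eval z) := by
    intro ω b'
    simp only [initForm, coeffOrd_taylor_map, coeffAc_taylor_map]
    rfl
  have hdf : ∀ (ω : A →+* LaurentSeries ℂ) k b', (taylor b' ((f k).map ω)).natDegree ≤ N :=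
    fun ω k b' => by rw [natDegree_taylor]; exact natDegree_map_le.trans (hfN k)
  have hdq : ∀ (ω : A →+* LaurentSeries ℂ) b', (taylor b' (q.map ω)).natDegree ≤ N :=
    fun ω b' => by rw [natDegree_taylor]; exact natDegree_map_le.trans hqN
  have hsound : ∀ ω b', ψ (eval₂RingHom ω b') → ∃ b, q.eval₂ ω b = 0 ∧
      D (fun k => ord ((f k).eval₂ ω b)) (fun k => ac ((f k).eval₂ ω b)) := by
    intro ω b' h
    obtain ⟨γ, z, hzγ, h1, h2, h3⟩ := (hψ' ω b').1 h
    obtain ⟨u, rfl, rfl, hu⟩ := exists_root_of_ord_ac (hdq ω b') hzγ h2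
    refine ⟨u + b', ?_, ?_⟩
    · rwa [taylor_eval, eval_map] at hu
    · have := fun k => ord_ac_eval (hdf ω k b') (h1 k)
      simp only [taylor_eval, eval_map] at this
      simpa only [(this _).1, (this _).2] using h3
  have h0 : QPred fun ω : A →+* LaurentSeries ℂ => ψ (eval₂RingHom ω 0) := by
    refine (hψ.comap (evalRingHom (0 : A))).congr fun ω => ?_
    suffices eval₂RingHom ω 0 = ω.comp (evalRingHom (0 : A)) by rw [this]
    ext <;> simp
  have h1 : QPred fun ω : A →+* LaurentSeries ℂ => ∃ x : κ × Fin (N + 1),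
      (hasseDeriv x.2 (f x.1)).map ω ≠ 0 ∧
        ∃ b, (hasseDeriv x.2 (f x.1)).eval₂ ω b = 0 ∧ ψ (eval₂RingHom ω b) :=
    QPred.exists_finite fun x => hf _ _ _ hψ
  have h2 : QPred fun ω : A →+* LaurentSeries ℂ => ∃ j : Fin N,
      (hasseDeriv (j + 1) q).map ω ≠ 0 ∧
        ∃ b, (hasseDeriv (j + 1) q).eval₂ ω b = 0 ∧ ψ (eval₂RingHom ω b) :=
    QPred.exists_finite fun j => hq _ _ hψ
  refine (h0.or (h1.or h2)).congr fun ω => ⟨?_, ?_⟩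
  · rintro ⟨b, hb, hDb⟩
    obtain ⟨b', hb', hc1, hc2⟩ := exists_center (fun k => (f k).map ω)
      (fun k => natDegree_map_le.trans (hfN k)) (natDegree_map_le.trans hqN) (b := b)
      (by rwa [eval_map])
    have hcond : ψ (eval₂RingHom ω b') := by
      rw [hψ']
      refine ⟨ord (b - b'), ac (b - b'), ac_eq_zero_iff_ord_eq_top _, hc1, hc2, ?_⟩
      have := fun k => ord_ac_eval (hdf ω k b') (hc1 k)
      simp only [taylor_eval, eval_map, sub_add_cancel] at this
      simpa only [← (this _).1, ← (this _).2] using hDb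
    rcases hb' with rfl | ⟨k, j, hj, hj0⟩ | ⟨j, hj1, hj, hj0⟩
    · exact Or.inl hcond
    · rw [← map_hasseDeriv] at hj hj0
      have hjN : j < N + 1 := by
        by_contra hlt
        refine hj ?_
        rw [hasseDeriv_eq_zero_of_lt_natDegree _ _ ((hfN k).trans_lt (by omega)),
          Polynomial.map_zero]
      exact Or.inr (Or.inl ⟨(k, ⟨j, hjN⟩), hj, b', by rwa [eval_map] at hj0, hcond⟩)
    · rw [← map_hasseDeriv] at hj hj0
      have hjN : j < N + 1 := by
        by_contra hlt
        refine hj ?_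
        rw [hasseDeriv_eq_zero_of_lt_natDegree _ _ (hqN.trans_lt (by omega)),
          Polynomial.map_zero]
      obtain ⟨j, rfl⟩ : ∃ i, j = i + 1 := ⟨j - 1, by omega⟩
      exact Or.inr (Or.inr ⟨⟨j, by omega⟩, hj, b', by rwa [eval_map] at hj0, hcond⟩)
  · rintro (h | ⟨-, -, b', -, h⟩ | ⟨-, -, b', -, h⟩)
    · exact hsound _ _ h
    · exact hsound _ _ h
    · exact hsound _ _ h

theorem exists_pseudo_division {A : Type*} [CommRing A] {q : A[X]} (hq : 0 < q.natDegree)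
    (f : A[X]) : ∃ (n : ℕ) (Q R : A[X]), C q.leadingCoeff ^ n * f = Q * q + R ∧
      R.natDegree < q.natDegree := by
  obtain ⟨m, hm⟩ : ∃ m, f.natDegree ≤ m := ⟨_, le_rfl⟩
  induction m generalizing f with
  | zero => exact ⟨0, 0, f, by simp, by omega⟩
  | succ m ih =>
    by_cases hlt : f.natDegree < q.natDegree
    · exact ⟨0, 0, f, by simp, hlt⟩
    obtain ⟨n, Q, R, h, hR⟩ := ih (C q.leadingCoeff * f -
      C (f.coeff (m + 1)) * (X ^ (m + 1 - q.natDegree) * q)) (by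
        rw [natDegree_le_iff_coeff_eq_zero]
        intro k hk
        rw [coeff_sub, coeff_C_mul, coeff_C_mul, coeff_X_pow_mul', if_pos (by omega)]
        rcases eq_or_lt_of_le (Nat.succ_le_of_lt hk) with rfl | hk'
        · rw [show m + 1 - (m + 1 - q.natDegree) = q.natDegree by omega]
          rw [coeff_natDegree]
          ring
        · rw [coeff_eq_zero_of_natDegree_lt (p := f) (by omega),
            coeff_eq_zero_of_natDegree_lt (p := q) (by omega)]
          ring)
    exact ⟨n + 1, Q + C q.leadingCoeff ^ n * C (f.coeff (m + 1)) * X ^ (m + 1 - q.natDegree), R,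
      by linear_combination h, hR⟩

theorem nsmul_coe_ne_top {x : WithTop ℤ} (hx : x ≠ ⊤) (n : ℕ) : n • x ≠ ⊤ := by
  lift x to ℤ using hx
  rw [← WithTop.coe_nsmul]
  exact WithTop.coe_ne_top

/-- Tame conditions on pseudo-remainders. -/
theorem tame_pseudo_remainder {κ : Type*} [Finite κ] (n : κ → ℕ)
    {D : (κ → WithTop ℤ) → (κ → ℂ) → Prop} (hD : Tame D) :
    Tame fun (g : Option κ → WithTop ℤ) (y : Option κ → ℂ) =>
      ∃ (e : κ → WithTop ℤ) (w : κ → ℂ), (∀ k, e k + n k • g none = g (some k)) ∧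
        (∀ k, w k * y none ^ n k = y (some k)) ∧ D e w := by
  refine Tame.exists_index (Tame.exists_fun (Tame.and (Tame.const _) (Tame.and ?_ ?_)))
  · exact Tame.forall_finite fun k => Tame.of_cdef
      (((CDefFun.var _).mul ((CDefFun.var _).pow _)).eq (CDefFun.var _))
  · exact (hD.comp Prod.snd).preimage (fun _ => ()) (F := fun _ y k => y (Sum.inr k))
      fun _ k => CDefFun.var _

theorem elim_all {A : Type*} [CommRing A] (q : A[X]) : Elim q := by
  obtain ⟨d, hd⟩ : ∃ d, q.natDegree = d := ⟨_, rfl⟩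
  induction d using Nat.strong_induction_on generalizing q with
  | _ d ih =>
  intro p hp
  rcases Nat.eq_zero_or_pos d with rfl | hd0
  · refine (QPred.const False).congr fun ω => ⟨fun ⟨h, b, hb, _⟩ => h ?_, False.elim⟩
    rw [eq_C_of_natDegree_eq_zero hd] at hb ⊢
    rw [eval₂_C] at hb
    rw [map_C, hb, C_0]
  have hlow : ∀ h : A[X], h.natDegree < d → ∀ j, Elim (hasseDeriv j h) := fun h hh j =>
    ih _ (((natDegree_hasseDeriv_le h j).trans (Nat.sub_le _ _)).trans_lt hh) _ rfl
  have herase : Elim q.eraseLead := ih _ (by have := q.eraseLead_natDegree_le; omega) _ rfl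
  obtain ⟨m, f, D, hD, hpD⟩ := id hp
  choose n Q R hdiv hR using fun k => exists_pseudo_division (hd.symm ▸ hd0) (f k)
  let f' : Option (Fin m) → A[X] := fun o => o.elim (C q.leadingCoeff) R
  have hmain := QPred.exists_root q f' (tame_pseudo_remainder n hD)
    (by
      rintro (_ | k) j
      · exact hlow _ (by simpa [f'] using hd0) j
      · exact hlow _ (hd ▸ hR k) j)
    (fun j => ih _ (by have := natDegree_hasseDeriv_le q (j + 1); omega) _ rfl)
  refine (((QPred.eq_zero q.leadingCoeff).and (herase p hp)).or
    ((QPred.eq_zero q.leadingCoeff).not.and hmain)).congr fun ω => ?_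
  by_cases hl : ω q.leadingCoeff = 0
  · have hmap : q.map ω = q.eraseLead.map ω := by
      rw [← congrArg (Polynomial.map ω) q.eraseLead_add_C_mul_X_pow, Polynomial.map_add,
        Polynomial.map_mul, map_C, hl, C_0, zero_mul, add_zero]
    simp only [hl, not_true_eq_false, false_and, or_false, true_and, ← eval_map, hmap]
  · have hmap : q.map ω ≠ 0 := fun h => hl (by
      have := congrArg (fun r => r.coeff q.natDegree) h
      simpa using this)
    simp only [hl, not_false_eq_true, false_and, false_or, true_and]
    rw [and_iff_right hmap]
    refine exists_congr fun b => and_congr_right fun hb => ?_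
    rw [hpD]
    have hrem : ∀ k, (f k).eval₂ ω b * ω q.leadingCoeff ^ n k = (R k).eval₂ ω b := fun k => by
      have := congrArg (eval₂RingHom ω b) (hdiv k)
      simp only [map_mul, map_add, map_pow, coe_eval₂RingHom, eval₂_C, hb] at this
      linear_combination this
    have hg : ord (ω q.leadingCoeff) ≠ ⊤ := by simpa [ord] using hl
    have ha : ac (ω q.leadingCoeff) ≠ 0 := by simpa [ac] using hl
    have ho : ∀ k, ord ((f k).eval₂ ω b) + n k • ord (ω q.leadingCoeff) =
        ord ((R k).eval₂ ω b) := fun k => by rw [← ord_pow, ← ord_mul, hrem]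
    have hc : ∀ k, ac ((f k).eval₂ ω b) * ac (ω q.leadingCoeff) ^ n k =
        ac ((R k).eval₂ ω b) := fun k => by rw [← ac_pow, ← ac_mul, hrem]
    simp only [f', Option.elim_none, Option.elim_some, eval₂_C, ← ho, ← hc, coe_eval₂RingHom]
    constructor
    · intro h
      exact ⟨_, _, fun k => rfl, fun k => rfl, h⟩
    · rintro ⟨e, w, he, hw, h⟩
      obtain rfl : e = fun k => ord ((f k).eval₂ ω b) := funext fun k =>
        WithTop.add_right_cancel (nsmul_coe_ne_top hg _) (he k)
      obtain rfl : w = fun k => ac ((f k).eval₂ ω b) := funext fun k =>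
        mul_right_cancel₀ (pow_ne_zero _ ha) (hw k)
      exact h

/-- Projections of tame predicates are tame. -/
theorem QPred.exists_point {A : Type*} [CommRing A] {p : (A[X] →+* LaurentSeries ℂ) → Prop}
    (hp : QPred p) : QPred fun ω : A →+* LaurentSeries ℂ => ∃ b, p (eval₂RingHom ω b) := by
  obtain ⟨n, f, D, hD, h⟩ := hp
  refine (QPred.exists_root (0 : A[X]) f hD (fun _ _ => elim_all _) fun _ => elim_all _).congr
    fun ω => ?_
  simp [h]

section Realize

attribute [local instance] laurentStructure

theorem valuation_le_exp_iff (m : ℤ) (x : LaurentSeries ℂ) :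
    (Valued.v x : WithZero (Multiplicative ℤ)) ≤ WithZero.exp (-m) ↔ (m : WithTop ℤ) ≤ ord x := by
  rw [LaurentSeries.valuation_le_iff_coeff_lt_eq_zero, le_ord_iff]

theorem valuation_le_iff_ord_le (x y : LaurentSeries ℂ) :
    (Valued.v x : WithZero (Multiplicative ℤ)) ≤ Valued.v y ↔ ord y ≤ ord x := by
  have key : ∀ z : LaurentSeries ℂ, ∀ m : ℤ, (Valued.v z : WithZero (Multiplicative ℤ)) ≤
    WithZero.exp m ↔ ((-m : ℤ) : WithTop ℤ) ≤ ord z := fun z m => by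
      rw [← valuation_le_exp_iff, neg_neg]
  rcases eq_or_ne y 0 with rfl | hy
  · simp
  · have hv : (Valued.v y : WithZero (Multiplicative ℤ)) ≠ 0 := by simpa
    obtain ⟨m, hm⟩ : ∃ m : ℤ, ord y = m := by
      rcases h : ord y with _ | m
      · exact absurd (HahnSeries.orderTop_eq_top.1 h) hy
      · exact ⟨m, rfl⟩
    have h1 : (Valued.v y : WithZero (Multiplicative ℤ)) = WithZero.exp (-m) := by
      refine le_antisymm ((valuation_le_exp_iff m y).2 hm.ge) ?_
      by_contra hlt
      have h3 := (WithZero.log_lt_iff_lt_exp hv).2 (not_le.1 hlt)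
      have h4 := (valuation_le_exp_iff (m + 1) y).1 ((WithZero.log_le_iff_le_exp hv).1 (by lia))
      rw [hm] at h4
      have := WithTop.coe_le_coe.1 h4
      omega
    rw [h1, valuation_le_exp_iff, hm]

theorem valuation_eq_uniformizer_iff (x : LaurentSeries ℂ) :
    (Valued.v x : WithZero (Multiplicative ℤ)) =
      ((Multiplicative.ofAdd (-1 : ℤ) : Multiplicative ℤ) : WithZero (Multiplicative ℤ)) ↔
      ord x = (1 : ℤ) := by
  have hs : ord (HahnSeries.single (1 : ℤ) (1 : ℂ) : LaurentSeries ℂ) = (1 : ℤ) :=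
    HahnSeries.orderTop_single one_ne_zero
  have h : (Valued.v (HahnSeries.single (1 : ℤ) (1 : ℂ) : LaurentSeries ℂ) :
      WithZero (Multiplicative ℤ)) = WithZero.exp (-1 : ℤ) :=
    LaurentSeries.valuation_single_zpow ℂ 1
  change _ = WithZero.exp (-1 : ℤ) ↔ _
  rw [← h, ← hs, le_antisymm_iff, le_antisymm_iff, valuation_le_iff_ord_le,
    valuation_le_iff_ord_le, and_comm]

open MvPolynomial in
theorem exists_mvPolynomial_realize {β : Type*} (t : LVR.Term β) :
    ∃ P : MvPolynomial β ℤ, ∀ ω : MvPolynomial β ℤ →+* LaurentSeries ℂ,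
      ω P = t.realize fun b => ω (X b) := by
  induction t with
  | var b => exact ⟨X b, fun ω => rfl⟩
  | func f ts ih =>
    choose P hP using ih
    cases f with
    | zero => exact ⟨0, fun ω => map_zero ω⟩
    | one => exact ⟨1, fun ω => map_one ω⟩
    | add => exact ⟨P 0 + P 1, fun ω => by rw [map_add, hP, hP]; rfl⟩
    | mul => exact ⟨P 0 * P 1, fun ω => by rw [map_mul, hP, hP]; rfl⟩

theorem QPred.of_ord {A : Type*} [CommRing A] {κ : Type*} [Finite κ] (f : κ → A)
    (p : (κ → WithTop ℤ) → Prop) : QPred fun ω => p fun i => ord (ω (f i)) :=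
  QPred.intro f (Tame.const p) fun _ => Iff.rfl

theorem QPred.isPow {A : Type*} [CommRing A] (a : A) (n : ℕ) :
    QPred fun ω => ∃ y, ω a = y ^ n := by
  refine (QPred.exists_point (QPred.eq_zero (C a - X ^ n : A[X]))).congr fun ω => ?_
  simp [sub_eq_zero]

open MvPolynomial in
theorem qPred_realize {α : Type*} {n : ℕ} (φ : LVR.BoundedFormula α n) :
    QPred fun ω : MvPolynomial (α ⊕ Fin n) ℤ →+* LaurentSeries ℂ =>
      φ.Realize (fun a => ω (X (Sum.inl a))) (fun i => ω (X (Sum.inr i))) := by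
  induction φ with
  | falsum => exact QPred.const False
  | equal t₁ t₂ =>
    obtain ⟨P, hP⟩ := exists_mvPolynomial_realize t₁
    obtain ⟨Q, hQ⟩ := exists_mvPolynomial_realize t₂
    refine (QPred.eq_zero (P - Q)).congr fun ω => ?_
    rw [map_sub, sub_eq_zero, hP, hQ, Language.BoundedFormula.Realize]
    rw [← Sum.elim_comp_inl_inr fun b => ω (X b)]
    rfl
  | rel R ts =>
    choose P hP using fun i => exists_mvPolynomial_realize (ts i)
    replace hP := fun i ω => (hP i ω).trans
      (congrArg (fun e => (ts i).realize e) (Sum.elim_comp_inl_inr fun b => ω (X b)).symm)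
    cases R with
    | dvd =>
      refine (QPred.of_ord P fun g => g 0 ≤ g 1).congr fun ω => ?_
      rw [← valuation_le_iff_ord_le, hP, hP]; rfl
    | N =>
      refine (QPred.of_ord P fun g => g 0 = (1 : ℤ)).congr fun ω => ?_
      rw [← valuation_eq_uniformizer_iff, hP]; rfl
    | pow m =>
      refine (QPred.isPow (P 0) m).congr fun ω => ?_
      rw [hP]; rfl
  | imp φ ψ hφ hψ =>
    refine (hφ.not.or hψ).congr fun ω => ?_
    rw [Language.BoundedFormula.realize_imp, imp_iff_not_or]
  | @all n φ hφ =>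
    let g : MvPolynomial (α ⊕ Fin (n + 1)) ℤ →+* (MvPolynomial (α ⊕ Fin n) ℤ)[X] :=
      MvPolynomial.eval₂Hom (Int.castRingHom _) (Sum.elim (fun a => Polynomial.C (X (Sum.inl a)))
        (Fin.snoc (α := fun _ => (MvPolynomial (α ⊕ Fin n) ℤ)[X])
          (fun i => Polynomial.C (X (Sum.inr i))) Polynomial.X))
    refine (QPred.exists_point (hφ.not.comap g)).not.congr fun ω => ?_
    rw [Language.BoundedFormula.realize_all, not_exists]
    refine forall_congr' fun b => ?_
    rw [not_not]
    refine iff_of_eq (congrArg₂ _ ?_ ?_)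
    · ext a; simp [g]
    · ext i
      refine Fin.lastCases ?_ (fun i => ?_) i <;> simp [g]

end Realize

theorem exists_ker_eval_eq_ker {A R S M : Type*} [CommRing A] [CommRing R] [CommRing S] [Field M]
    [IsAlgClosed M] [IsDomain S] [Algebra R S] [Algebra R M] [FaithfulSMul R S] [FaithfulSMul R M]
    (ρ : A →+* R) (π : A[X] →+* S) (hπ : Function.Surjective π)
    (hρ : ∀ a, algebraMap R S (ρ a) = π (C a)) {g : A[X]} (hg : π g = 0) (hgρ : g.map ρ ≠ 0) :
    ∃ b : M, RingHom.ker (eval₂RingHom ((algebraMap R M).comp ρ) b) = RingHom.ker π := by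
  have : IsDomain R := (FaithfulSMul.algebraMap_injective R S).isDomain _
  have hπ_eval : ∀ h : A[X], aeval (π X) (h.map ρ) = π h := fun h => by
    have : (algebraMap R S).comp ρ = π.comp C := RingHom.ext hρ
    rw [aeval_def, eval₂_map, this, ← hom_eval₂, eval₂_C_X]
  have hx : IsAlgebraic R (π X) := ⟨g.map ρ, hgρ, by rw [hπ_eval, hg]⟩
  have htop : Algebra.adjoin R {π X} = ⊤ := by
    refine eq_top_iff.2 fun z _ => ?_
    obtain ⟨h, rfl⟩ := hπ z
    have h_mem := aeval_mem_adjoin_singleton R (π X) (p := h.map ρ)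
    rwa [hπ_eval] at h_mem
  have : Algebra.IsAlgebraic R S := by
    have := Algebra.isAlgebraic_adjoin_singleton_iff.2 hx
    rw [htop] at this
    exact ⟨fun z => this z trivial⟩
  let L : S →ₐ[R] M := IsAlgClosed.lift
  have hL : RingHom.ker L = ⊥ := by
    refine eq_bot_iff.2 fun z hz => ?_
    by_contra hz0
    refine Ideal.comap_ne_bot_of_algebraic_mem hz0 hz (Algebra.IsAlgebraic.isAlgebraic (R := R) z)
      (eq_bot_iff.2 fun a ha => ?_)
    have ha' : L (algebraMap R S a) = 0 := ha
    rw [AlgHom.commutes] at ha'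
    exact FaithfulSMul.algebraMap_injective R M (ha'.trans (map_zero _).symm)
  refine ⟨L (π X), ?_⟩
  have : eval₂RingHom ((algebraMap R M).comp ρ) (L (π X)) = (L : S →+* M).comp π := by
    refine Polynomial.ringHom_ext (fun a => ?_) (by simp)
    rw [coe_eval₂RingHom, eval₂_C, RingHom.comp_apply, RingHom.comp_apply, ← hρ]
    exact (L.commutes (ρ a)).symm
  rw [this, ← RingHom.comap_ker]
  change Ideal.comap _ (RingHom.ker L) = _
  rw [hL, ← RingHom.ker_eq_comap_bot]

theorem exists_ker_eval_eq {A : Type*} [CommRing A] (ω : A →+* ℂ) (Q : Ideal A[X]) [Q.IsPrime]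
    (hQ : Q.comap C = RingHom.ker ω) {g : A[X]} (hg : g ∈ Q) (hgω : g.map ω ≠ 0) :
    ∃ b : ℂ, RingHom.ker (eval₂RingHom ω b) = Q := by
  let P := Q.comap (C : A →+* A[X])
  let ψ : A ⧸ P →+* ℂ := Ideal.Quotient.lift P ω fun a ha => by rwa [← RingHom.mem_ker, ← hQ]
  let : Algebra (A ⧸ P) ℂ := ψ.toAlgebra
  let : Algebra (A ⧸ P) (A[X] ⧸ Q) := (Ideal.quotientMap Q C le_rfl).toAlgebra
  have : FaithfulSMul (A ⧸ P) (A[X] ⧸ Q) :=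
    (faithfulSMul_iff_algebraMap_injective _ _).2 Ideal.quotientMap_injective
  have : FaithfulSMul (A ⧸ P) ℂ := (faithfulSMul_iff_algebraMap_injective _ _).2
    (RingHom.lift_injective_of_ker_le_ideal _ _ hQ.ge)
  obtain ⟨b, hb⟩ := exists_ker_eval_eq_ker (M := ℂ) (Ideal.Quotient.mk P) (Ideal.Quotient.mk Q)
    Ideal.Quotient.mk_surjective (fun a => rfl) (Ideal.Quotient.eq_zero_iff_mem.2 hg) fun h => by
      have := congrArg (Polynomial.map ψ) h
      rw [Polynomial.map_map, Polynomial.map_zero] at this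
      exact hgω this
  rw [Ideal.mk_ker] at hb
  exact ⟨b, hb⟩

open PrimeSpectrum Topology in
/-- A predicate on the complex points of `A` that defines a constructible subset of the prime
spectrum. -/
def CPred {A : Type*} [CommRing A] (p : (A →+* ℂ) → Prop) : Prop :=
  ∃ S : Set (PrimeSpectrum A), IsConstructible S ∧ ∀ ω, p ω ↔ comap ω ⊥ ∈ S

namespace CPred

open PrimeSpectrum Topology

variable {A B : Type*} [CommRing A] [CommRing B] {p q : (A →+* ℂ) → Prop}

theorem congr (hp : CPred p) (h : ∀ ω, q ω ↔ p ω) : CPred q := by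
  rwa [funext fun ω => propext (h ω)]

theorem not (hp : CPred p) : CPred fun ω => ¬ p ω := by
  obtain ⟨S, hS, h⟩ := hp
  exact ⟨Sᶜ, isConstructible_compl.2 hS, fun ω => not_congr (h ω)⟩

theorem or (hp : CPred p) (hq : CPred q) : CPred fun ω => p ω ∨ q ω := by
  obtain ⟨S, hS, h⟩ := hp
  obtain ⟨T, hT, h'⟩ := hq
  exact ⟨S ∪ T, hS.union hT, fun ω => or_congr (h ω) (h' ω)⟩

theorem eq_zero (a : A) : CPred fun ω => ω a = 0 := by
  refine ⟨(basicOpen a : Set (PrimeSpectrum A))ᶜ,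
    isConstructible_compl.2 isConstructible_basicOpen, fun ω => ?_⟩
  simp

theorem comap (hp : CPred p) (g : A →+* B) : CPred fun ω : B →+* ℂ => p (ω.comp g) := by
  obtain ⟨S, hS, h⟩ := hp
  obtain ⟨S, rfl⟩ := exists_constructibleSetData_iff.2 hS
  refine ⟨_, (S.map g).isConstructible_toSet, fun ω => ?_⟩
  rw [ConstructibleSetData.toSet_map, Set.mem_preimage]
  exact h _

theorem exists_point {p : (A[X] →+* ℂ) → Prop} (hp : CPred p) :
    CPred fun ω => ∃ b, p (eval₂RingHom ω b) := by
  obtain ⟨S, hS, h⟩ := hp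
  refine ⟨_, isConstructible_comap_C hS, fun ω => ?_⟩
  simp only [h]
  constructor
  · rintro ⟨b, hb⟩
    refine ⟨_, hb, ?_⟩
    ext a
    simp
  · rintro ⟨Q, hQS, hQ⟩
    have hQ' : Q.asIdeal.comap C = RingHom.ker ω := congrArg PrimeSpectrum.asIdeal hQ
    by_cases hg : ∃ g ∈ Q.asIdeal, g.map ω ≠ 0
    · obtain ⟨g, hg, hgω⟩ := hg
      obtain ⟨b, hb⟩ := exists_ker_eval_eq ω Q.asIdeal hQ' hg hgω
      refine ⟨b, ?_⟩
      convert hQS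
      ext1
      exact hb
    · push Not at hg
      obtain ⟨S, rfl⟩ := exists_constructibleSetData_iff.2 hS
      simp only [ConstructibleSetData.toSet, Set.mem_iUnion] at hQS ⊢
      obtain ⟨c, hc, hg0, hf0⟩ := hQS
      have hf : c.f.map ω ≠ 0 := by
        intro hf
        refine hf0 ?_
        rw [mem_zeroLocus, Set.singleton_subset_iff]
        change c.f ∈ Q.asIdeal
        refine (Ideal.mem_map_C_iff.2 fun n => ?_ : c.f ∈ (Q.asIdeal.comap C).map C) |>
          fun h => Ideal.map_comap_le h
        rw [hQ', RingHom.mem_ker, ← coeff_map, hf, coeff_zero]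
      obtain ⟨b, hb⟩ := Polynomial.exists_eval_ne_zero_of_natDegree_lt_card _ hf
        (Cardinal.natCast_lt_aleph0.trans_le (Cardinal.aleph0_le_mk ℂ))
      refine ⟨b, c, hc, ?_, ?_⟩
      · rw [mem_zeroLocus]
        intro g hgc
        have := hg g (hg0 hgc)
        change eval₂ ω b g = 0
        rw [← eval_map, this, eval_zero]
      · rw [mem_zeroLocus, Set.singleton_subset_iff]
        change ¬ eval₂ ω b c.f = 0
        rwa [← eval_map]

end CPred

section CRealize

open MvPolynomial in
theorem exists_mvPolynomial_realize_ring {β : Type*} (t : Language.ring.Term β) :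
    ∃ P : MvPolynomial β ℤ, ∀ ω : MvPolynomial β ℤ →+* ℂ,
      ω P = t.realize fun b => ω (X b) := by
  induction t with
  | var b => exact ⟨X b, fun ω => rfl⟩
  | func f ts ih =>
    choose P hP using ih
    cases f with
    | add => exact ⟨P 0 + P 1, fun ω => by rw [map_add, hP, hP]; rfl⟩
    | mul => exact ⟨P 0 * P 1, fun ω => by rw [map_mul, hP, hP]; rfl⟩
    | neg => exact ⟨-P 0, fun ω => by rw [map_neg, hP]; rfl⟩
    | zero => exact ⟨0, fun ω => map_zero ω⟩
    | one => exact ⟨1, fun ω => map_one ω⟩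

open MvPolynomial in
theorem cPred_realize {α : Type*} {n : ℕ} (φ : Language.ring.BoundedFormula α n) :
    CPred fun ω : MvPolynomial (α ⊕ Fin n) ℤ →+* ℂ =>
      φ.Realize (fun a => ω (X (Sum.inl a))) (fun i => ω (X (Sum.inr i))) := by
  induction φ with
  | falsum => exact (CPred.eq_zero 1).congr (by simp [Language.BoundedFormula.Realize])
  | equal t₁ t₂ =>
    obtain ⟨P, hP⟩ := exists_mvPolynomial_realize_ring t₁
    obtain ⟨Q, hQ⟩ := exists_mvPolynomial_realize_ring t₂
    refine (CPred.eq_zero (P - Q)).congr fun ω => ?_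
    rw [map_sub, sub_eq_zero, hP, hQ, Language.BoundedFormula.Realize]
    rw [← Sum.elim_comp_inl_inr fun b => ω (X b)]
    rfl
  | rel R ts => exact isEmptyElim R
  | imp φ ψ hφ hψ =>
    refine (hφ.not.or hψ).congr fun ω => ?_
    rw [Language.BoundedFormula.realize_imp, imp_iff_not_or]
  | @all n φ hφ =>
    let g : MvPolynomial (α ⊕ Fin (n + 1)) ℤ →+* (MvPolynomial (α ⊕ Fin n) ℤ)[X] :=
      MvPolynomial.eval₂Hom (Int.castRingHom _) (Sum.elim (fun a => Polynomial.C (X (Sum.inl a)))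
        (Fin.snoc (α := fun _ => (MvPolynomial (α ⊕ Fin n) ℤ)[X])
          (fun i => Polynomial.C (X (Sum.inr i))) Polynomial.X))
    refine (CPred.exists_point (hφ.not.comap g)).not.congr fun ω => ?_
    rw [Language.BoundedFormula.realize_all, not_exists]
    refine forall_congr' fun b => ?_
    rw [not_not]
    refine iff_of_eq (congrArg₂ _ ?_ ?_)
    · ext a; simp [g]
    · ext i
      refine Fin.lastCases ?_ (fun i => ?_) i <;> simp [g]

end CRealize

theorem CPred.exists_finset {A : Type*} [CommRing A] {p : (A[X] →+* ℂ) → Prop} (hp : CPred p) :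
    ∃ N, ∀ ω : A →+* ℂ, ∃ Z : Finset ℂ, Z.card ≤ N ∧
      ((∀ z, p (eval₂RingHom ω z) → z ∈ Z) ∨ ∀ z ∉ Z, p (eval₂RingHom ω z)) := by
  classical
  obtain ⟨S, hS, h⟩ := hp
  obtain ⟨S, rfl⟩ := PrimeSpectrum.exists_constructibleSetData_iff.2 hS
  let G : Finset A[X] := S.biUnion fun c => insert c.f (Finset.univ.image c.g)
  refine ⟨∑ g ∈ G, g.natDegree, fun ω => ⟨G.biUnion fun g => (g.map ω).roots.toFinset, ?_, ?_⟩⟩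
  · refine Finset.card_biUnion_le.trans (Finset.sum_le_sum fun g _ => ?_)
    exact (Multiset.toFinset_card_le _).trans ((card_roots' _).trans natDegree_map_le)
  · have hG : ∀ z ∉ G.biUnion fun g => (g.map ω).roots.toFinset, ∀ g ∈ G,
        eval₂RingHom ω z g = 0 ↔ g.map ω = 0 := by
      intro z hz g hg
      rw [coe_eval₂RingHom, ← eval_map]
      refine ⟨fun h0 => ?_, fun h0 => by rw [h0, eval_zero]⟩
      by_contra hne
      exact hz (Finset.mem_biUnion.2 ⟨g, hg, Multiset.mem_toFinset.2 ((mem_roots hne).2 h0)⟩)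
    have hkey : ∀ z ∉ G.biUnion fun g => (g.map ω).roots.toFinset,
        (p (eval₂RingHom ω z) ↔ ∃ c ∈ S, (∀ i, (c.g i).map ω = 0) ∧ c.f.map ω ≠ 0) := by
      intro z hz
      rw [h]
      simp only [PrimeSpectrum.ConstructibleSetData.toSet, Set.mem_iUnion, exists_prop]
      refine exists_congr fun c => and_congr_right fun hc => and_congr ?_ (not_congr ?_)
      · rw [PrimeSpectrum.mem_zeroLocus, Set.range_subset_iff]
        refine forall_congr' fun i => hG z hz _ (Finset.mem_biUnion.2 ⟨c, hc, ?_⟩)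
        exact Finset.mem_insert_of_mem (Finset.mem_image_of_mem _ (Finset.mem_univ i))
      · rw [PrimeSpectrum.mem_zeroLocus, Set.singleton_subset_iff]
        exact hG z hz _ (Finset.mem_biUnion.2 ⟨c, hc, Finset.mem_insert_self _ _⟩)
    by_cases hT : ∃ c ∈ S, (∀ i, (c.g i).map ω = 0) ∧ c.f.map ω ≠ 0
    · exact Or.inr fun z hz => (hkey z hz).2 hT
    · exact Or.inl fun z hpz => by_contra fun hz => hT ((hkey z hz).1 hpz)

theorem CDef.exists_finset {ι : Type*} {p : (ι ⊕ Unit → ℂ) → Prop} (hp : CDef p) :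
    ∃ N, ∀ y : ι → ℂ, ∃ Z : Finset ℂ, Z.card ≤ N ∧
      ((∀ z, p (Sum.elim y fun _ => z) → z ∈ Z) ∨ ∀ z ∉ Z, p (Sum.elim y fun _ => z)) := by
  obtain ⟨φ, hφ⟩ := Set.empty_definable_iff.1 hp
  let g : MvPolynomial ((ι ⊕ Unit) ⊕ Fin 0) ℤ →+* (MvPolynomial ι ℤ)[X] :=
    MvPolynomial.eval₂Hom (Int.castRingHom _)
      (Sum.elim (Sum.elim (fun i => C (MvPolynomial.X i)) fun _ => X) Fin.elim0)
  obtain ⟨N, hN⟩ := ((cPred_realize φ).comap g).exists_finset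
  refine ⟨N, fun y => ?_⟩
  have hpφ : ∀ z, p (Sum.elim y fun _ => z) ↔ φ.Realize (Sum.elim y fun _ => z) := fun z =>
    Set.ext_iff.1 hφ (Sum.elim y fun _ => z)
  obtain ⟨Z, hZ, h⟩ := hN (MvPolynomial.eval₂Hom (Int.castRingHom ℂ) y)
  have hz : ∀ z, (fun a => ((eval₂RingHom (MvPolynomial.eval₂Hom (Int.castRingHom ℂ) y) z).comp g)
      (MvPolynomial.X (Sum.inl a))) = Sum.elim y fun _ => z := fun z => by
    ext (i | i) <;> simp [g]
  simp only [hz, Unique.eq_default] at h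
  simp only [hpφ]
  exact ⟨Z, hZ, h⟩

theorem Tame.exists_finset {Γ ι : Type*} {D : Γ → (ι ⊕ Unit → ℂ) → Prop} (hD : Tame D) :
    ∃ N, ∀ g, ∀ y : ι → ℂ, ∃ Z : Finset ℂ, Z.card ≤ N ∧
      ((∀ z, D g (Sum.elim y fun _ => z) → z ∈ Z) ∨ ∀ z ∉ Z, D g (Sum.elim y fun _ => z)) := by
  have hc : ∀ P : Set.range D, CDef P.1 := by rintro ⟨_, g, rfl⟩; exact hD.2 g
  choose N hN using fun P => (hc P).exists_finset
  have := hD.1.to_subtype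
  obtain ⟨M, hM⟩ := Finite.exists_le N
  refine ⟨M, fun g y => ?_⟩
  obtain ⟨Z, hZ, h⟩ := hN ⟨D g, g, rfl⟩ y
  exact ⟨Z, hZ.trans (hM _), h⟩

theorem ord_eq_zero_and_ac_eq_coeff {b : LaurentSeries ℂ} (hb : 0 ≤ ord b) (h0 : b.coeff 0 ≠ 0) :
    ord b = 0 ∧ ac b = b.coeff 0 := by
  refine ord_eq_and_ac_eq (m := 0) ?_ h0
  exact hb

theorem QPred.exists_finset {A : Type*} [CommRing A] {p : (A[X] →+* LaurentSeries ℂ) → Prop}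
    (hp : QPred p) : ∃ N, ∀ ω : A →+* LaurentSeries ℂ, ∃ Z : Finset ℂ, Z.card ≤ N ∧
      ((∀ b, 0 ≤ ord b → p (eval₂RingHom ω b) → b.coeff 0 ∈ Z) ∨
        ∀ b, 0 ≤ ord b → b.coeff 0 ∉ Z → p (eval₂RingHom ω b)) := by
  classical
  obtain ⟨n, f, D, hD, hpD⟩ := hp
  let d : Fin n → ℕ := fun k => (f k).natDegree
  let F (I : ∀ k, Finset (Fin (d k + 1))) (y : (Σ k, Fin (d k + 1)) ⊕ Unit → ℂ) (k : Fin n) : ℂ :=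
    (initPoly (I k) fun i => y (Sum.inl ⟨k, i⟩)).eval (y (Sum.inr ()))
  have hF : ∀ I k, CDefFun fun y => F I y k := fun I k => CDefFun.initPoly_eval _
    (a := fun i y => y (Sum.inl (⟨k, i⟩ : Σ k, Fin (d k + 1)))) (fun i => CDefFun.var _)
    (CDefFun.var _)
  have hD' : Tame fun (e : ∀ k, Fin (d k + 1) → WithTop ℤ) y =>
      D (fun k => minOrd (e k) 0) (F (fun k => leadSet (e k) 0) y) :=
    (hD.comp fun e k => minOrd (e k) 0).preimage
      (fun (e : ∀ k, Fin (d k + 1) → WithTop ℤ) k => leadSet (e k) 0) hF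
  obtain ⟨N, hN⟩ := hD'.exists_finset
  refine ⟨N + (1 + ∑ k, d k), fun ω => ?_⟩
  let q : Fin n → (LaurentSeries ℂ)[X] := fun k => (f k).map ω
  have hq : ∀ k, (q k).natDegree ≤ d k := fun k => natDegree_map_le
  obtain ⟨Z, hZ, h⟩ := hN (fun k => coeffOrd (d k) (q k)) fun i => coeffAc (d i.1) (q i.1) i.2
  let Z' : Finset ℂ := insert 0 (Finset.univ.biUnion fun k => (initForm (d k) (q k) 0).roots.toFinset)
  have hZ' : Z'.card ≤ 1 + ∑ k, d k := by
    refine (Finset.card_insert_le _ _).trans ?_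
    rw [add_comm]
    refine Nat.add_le_add_left (Finset.card_biUnion_le.trans (Finset.sum_le_sum fun k _ => ?_)) _
    refine (Multiset.toFinset_card_le _).trans ((card_roots' _).trans ?_)
    exact natDegree_le_iff_coeff_eq_zero.2 fun i hi => initPoly_coeff_of_lt _ _ hi
  have hkey : ∀ b, 0 ≤ ord b → b.coeff 0 ∉ Z' → (p (eval₂RingHom ω b) ↔
      D (fun k => minOrd (coeffOrd (d k) (q k)) 0)
        fun k => (initForm (d k) (q k) 0).eval (b.coeff 0)) := by
    intro b hb hbZ
    obtain ⟨ho, ha⟩ := ord_eq_zero_and_ac_eq_coeff hb fun h0 => hbZ (h0 ▸ Finset.mem_insert_self _ _)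
    have hr : ∀ k, ord ((q k).eval b) = minOrd (coeffOrd (d k) (q k)) 0 ∧
        ac ((q k).eval b) = (initForm (d k) (q k) 0).eval (b.coeff 0) := by
      intro k
      have := ord_ac_eval (hq k) (u := b)
      rw [ho, ha] at this
      refine this (or_iff_not_imp_left.2 fun hm h0 => hbZ (Finset.mem_insert_of_mem
        (Finset.mem_biUnion.2 ⟨k, Finset.mem_univ _, ?_⟩)))
      refine Multiset.mem_toFinset.2 ((mem_roots fun hi => ?_).2 h0)
      obtain ⟨i, hi'⟩ := exists_mem_leadSet (coeffOrd (d k) (q k)) 0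
      exact ac_coeff_ne_zero_of_mem_leadSet hm hi' (by rw [hi, coeff_zero])
    rw [hpD]
    simp only [coe_eval₂RingHom, ← eval_map]
    rw [funext fun k => (hr k).1, funext fun k => (hr k).2]
  refine ⟨Z ∪ Z', (Finset.card_union_le _ _).trans (Nat.add_le_add hZ hZ'), h.imp ?_ ?_⟩
  · intro h b hb hpb
    by_contra hbZ
    rw [Finset.mem_union, not_or] at hbZ
    exact hbZ.1 (h _ ((hkey b hb hbZ.2).1 hpb))
  · intro h b hb hbZ
    rw [Finset.mem_union, not_or] at hbZ
    exact (hkey b hb hbZ.2).2 (h _ hbZ.1)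

section Transfer

open FirstOrder.Language

/-- The formula `s ∣ t`. -/
def dvdFormula {β : Type*} (s t : LVR.Term β) : LVR.Formula β :=
  Relations.formula₂ (L := LVR) LVRRel.dvd s t

/-- The term `1`. -/
def oneTerm {β : Type*} : LVR.Term β := Term.func (L := LVR) (l := 0) LVRFunc.one ![]

/-- The term `s + t`. -/
def addTerm {β : Type*} (s t : LVR.Term β) : LVR.Term β :=
  Functions.apply₂ (L := LVR) LVRFunc.add s t

/-- The sentence expressing that every fibre of `φ` is, up to the residue classes of `N` points,
either disjoint from the valuation ring or contains it. -/
noncomputable def residueSentence {α : Type*} [Finite α] (φ : LVR.Formula (α ⊕ Fin 1)) (N : ℕ) :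
    LVR.Sentence :=
  let integral : LVR.Formula (((Empty ⊕ α) ⊕ Fin N) ⊕ Fin 1) :=
    dvdFormula oneTerm (Term.var (Sum.inr 0))
  let near : LVR.Formula (((Empty ⊕ α) ⊕ Fin N) ⊕ Fin 1) :=
    Formula.iSup fun i : Fin N =>
      (dvdFormula (addTerm (Term.var (Sum.inr 0)) (Term.var (Sum.inl (Sum.inr i)))) oneTerm).not
  let ψ : LVR.Formula (((Empty ⊕ α) ⊕ Fin N) ⊕ Fin 1) :=
    φ.relabel (Sum.map (Sum.inl ∘ Sum.inr) id)
  Formula.iAlls α (Formula.iExs (Fin N)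
    (Formula.iAlls (Fin 1) (integral.imp (ψ.imp near)) ⊔
      Formula.iAlls (Fin 1) (integral.imp (near.not.imp ψ))))

theorem realize_residueSentence {K : Type*} [Field K] {Γ₀ : Type*}
    [LinearOrderedCommGroupWithZero Γ₀] (v : Valuation K Γ₀) (γ₁ : Γ₀) {α : Type*} [Finite α]
    (φ : LVR.Formula (α ⊕ Fin 1)) (N : ℕ) :
    letI := valuedStructure v γ₁
    K ⊨ residueSentence φ N ↔ ∀ a : α → K, ∃ z : Fin N → K,
      (∀ x, v x ≤ 1 → φ.Realize (Sum.elim a fun _ => x) → ∃ i, v (x + z i) < 1) ∨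
      (∀ x, v x ≤ 1 → (¬ ∃ i, v (x + z i) < 1) → φ.Realize (Sum.elim a fun _ => x)) := by
  let := valuedStructure v γ₁
  let β := ((Empty ⊕ α) ⊕ Fin N) ⊕ Fin 1
  have hdvd : ∀ (s t : LVR.Term β) (e : β → K),
    (dvdFormula s t).Realize e ↔ v (t.realize e) ≤ v (s.realize e) := fun s t e =>
      Formula.realize_rel₂
  have hone : ∀ e : β → K, (oneTerm : LVR.Term β).realize e = 1 := fun e => rfl
  have hadd : ∀ (s t : LVR.Term β) (e : β → K),
    (addTerm s t).realize e = s.realize e + t.realize e := fun s t e => rfl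
  have hφ : ∀ (a : α → K) (z : Fin N → K) (x : Fin 1 → K) (d : Empty → K),
      (Sum.elim (Sum.elim (Sum.elim d a) z) x) ∘ (Sum.map (Sum.inl ∘ Sum.inr) id) =
      Sum.elim a fun _ => x 0 := fun a z x d => by
    ext (i | i)
    · rfl
    · simp [Subsingleton.elim i 0]
  have hfin : ∀ P : K → Prop, (∀ x : Fin 1 → K, P (x 0)) ↔ ∀ x, P x := fun P =>
    ⟨fun h x => h fun _ => x, fun h x => h _⟩
  simp only [residueSentence, Sentence.Realize, Formula.realize_iAlls, Formula.realize_iExs]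
  refine forall_congr' fun a => exists_congr fun z => ?_
  simp only [Formula.realize_sup, Formula.realize_iAlls, Formula.realize_imp, Formula.realize_not,
    Formula.realize_iSup, Formula.realize_relabel, hdvd, hone, hadd, Term.realize_var, map_one,
    not_le, Sum.elim_inl, Sum.elim_inr]
  rw [← hfin, ← hfin]
  simp only [← hφ a z _ default]

/-- The sentences `residueSentence φ N` hold in `ℂ((t))` for some `N`. -/
theorem exists_realize_residueSentence {α : Type*} [Finite α] (φ : LVR.Formula (α ⊕ Fin 1)) :
    letI := laurentStructure
    ∃ N, LaurentSeries ℂ ⊨ residueSentence φ N := by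
  let := laurentStructure
  let g : MvPolynomial ((α ⊕ Fin 1) ⊕ Fin 0) ℤ →+* (MvPolynomial α ℤ)[X] :=
    MvPolynomial.eval₂Hom (Int.castRingHom _)
      (Sum.elim (Sum.elim (fun i => C (MvPolynomial.X i)) fun _ => X) Fin.elim0)
  obtain ⟨N, hN⟩ := ((qPred_realize φ).comap g).exists_finset
  refine ⟨N, (realize_residueSentence _ _ φ N).2 fun a => ?_⟩
  obtain ⟨Z, hZ, h⟩ := hN (MvPolynomial.eval₂Hom (Int.castRingHom _) a)
  have hz : ∀ b, (fun c => ((eval₂RingHom (MvPolynomial.eval₂Hom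
      (Int.castRingHom (LaurentSeries ℂ)) a) b).comp g) (MvPolynomial.X (Sum.inl c))) =
      Sum.elim a fun _ => b := fun b => by
    ext1 (i | i) <;> simp [g]
  simp only [hz, Unique.eq_default] at h
  have hle : ∀ x : LaurentSeries ℂ, Valued.v x ≤ 1 ↔ 0 ≤ ord x := fun x => by
    simpa using valuation_le_exp_iff 0 x
  have hlt : ∀ (x : LaurentSeries ℂ) (c : ℂ), 0 ≤ ord x → x.coeff 0 = c →
      Valued.v (x + -HahnSeries.C c) < 1 := fun x c hx hc => by
    have h1 : ((1 : ℤ) : WithTop ℤ) ≤ ord (x + -HahnSeries.C c) := by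
      rw [le_ord_iff]
      intro n hn
      rw [HahnSeries.coeff_add, HahnSeries.coeff_neg]
      rcases (Int.le_of_lt_add_one (b := 0) hn).lt_or_eq with hn | rfl
      · rw [(le_ord_iff (m := 0)).1 hx n hn, HahnSeries.C_apply,
          HahnSeries.coeff_single_of_ne hn.ne, neg_zero, add_zero]
      · rw [hc, HahnSeries.C_apply, HahnSeries.coeff_single_same, add_neg_cancel]
    refine ((valuation_le_exp_iff 1 _).2 h1).trans_lt ?_
    rw [← WithZero.exp_zero, WithZero.exp_lt_exp]
    exact neg_one_lt_zero
  let e : Fin N → ℂ := fun i => Z.toList.getD i 0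
  have he : ∀ c ∈ Z, ∃ i, e i = c := fun c hc => by
    obtain ⟨i, hi, rfl⟩ := List.getElem_of_mem (Finset.mem_toList.2 hc)
    refine ⟨⟨i, lt_of_lt_of_le hi (by simpa using hZ)⟩, ?_⟩
    exact List.getD_eq_getElem _ _ hi
  have hnear : ∀ x : LaurentSeries ℂ, 0 ≤ ord x → x.coeff 0 ∈ Z →
      ∃ i, Valued.v (x + -HahnSeries.C (e i)) < 1 := fun x hx hxZ => by
    obtain ⟨i, hi⟩ := he _ hxZ
    exact ⟨i, hlt x _ hx hi.symm⟩
  refine ⟨fun i => -HahnSeries.C (e i), h.imp (fun h x hx hφ => ?_) fun h x hx hn => ?_⟩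
  · exact hnear x ((hle x).1 hx) (h x ((hle x).1 hx) hφ)
  · exact h x ((hle x).1 hx) fun hxZ => hn (hnear x ((hle x).1 hx) hxZ)

end Transfer

theorem residue_eq_residue_of_valuation_sub_lt_one {K : Type*} [Field K] {Γ₀ : Type*}
    [LinearOrderedCommGroupWithZero Γ₀] {v : Valuation K Γ₀} {a b : v.valuationSubring}
    (h : v ((a : K) - b) < 1) :
    IsLocalRing.residue v.valuationSubring a = IsLocalRing.residue v.valuationSubring b := by
  rw [← sub_eq_zero, ← map_sub, IsLocalRing.residue_eq_zero_iff, IsLocalRing.mem_maximalIdeal,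
    mem_nonunits_iff]
  rintro hu
  obtain ⟨c, hc⟩ := hu.exists_right_inv
  have h1 : v ((a : K) - b) * v (c : K) = 1 := by
    rw [← map_mul, ← map_one v]
    exact congrArg (fun d : v.valuationSubring => v (d : K)) hc
  exact absurd h1 (mul_lt_one_of_lt_of_le h ((v.mem_valuationSubring_iff _).1 c.2)).ne

end Tameness

/-- Let `K` be a valued field whose value group has a least positive
element, regarded as an `L_VR`-structure, elementarily equivalent to `ℂ((t))`.
Then for every `Y ⊆ O_K` definable in `K` by an `L_VR`-formula with parameters
from `K`, there is a finite `Z ⊆ k` such that either `Y ⊆ res⁻¹(Z)` or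
`res⁻¹(k ∖ Z) ⊆ Y`.  In particular `res(Y)` is finite or cofinite in `k`. -/
theorem stmt_8 {K : Type*} [Field K] {Γ₀ : Type*} [LinearOrderedCommGroupWithZero Γ₀]
    (v : Valuation K Γ₀) (hsurj : Function.Surjective v)
    (γ₁ : Γ₀) (hγ₁ : IsLeastPos γ₁) :
    letI : LVR.Structure K := valuedStructure v γ₁
    letI : LVR.Structure (LaurentSeries ℂ) := laurentStructure
    ∀ (_ : K ≅[LVR] LaurentSeries ℂ)
      (Y : Set K) (_ : ∀ y ∈ Y, y ∈ v.valuationSubring)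
      (_ : Set.Definable₁ (Set.univ : Set K) LVR Y),
      ∃ Z : Set (IsLocalRing.ResidueField v.valuationSubring), Z.Finite ∧
        ((∀ a : v.valuationSubring, (a : K) ∈ Y →
            IsLocalRing.residue v.valuationSubring a ∈ Z) ∨
         (∀ a : v.valuationSubring,
            IsLocalRing.residue v.valuationSubring a ∉ Z → (a : K) ∈ Y)) ∧
        ({u | ∃ a : v.valuationSubring, (a : K) ∈ Y ∧
            IsLocalRing.residue v.valuationSubring a = u}.Finite ∨
         {u | ∃ a : v.valuationSubring, (a : K) ∈ Y ∧
            IsLocalRing.residue v.valuationSubring a = u}ᶜ.Finite) := by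
  let := valuedStructure v γ₁
  let := laurentStructure
  intro hK Y _ hdef
  obtain ⟨A, -, hA⟩ := Set.definable_iff_finitely_definable.1 hdef
  obtain ⟨φ, hφ⟩ := Set.definable_iff_exists_formula_sum.1 hA
  have hmem : ∀ x : K, x ∈ Y ↔ φ.Realize (Sum.elim Subtype.val fun _ => x) := fun x =>
    Set.ext_iff.1 hφ fun _ => x
  obtain ⟨N, hN⟩ := exists_realize_residueSentence φ
  obtain ⟨z, hz⟩ := (realize_residueSentence v γ₁ φ N).1
    ((FirstOrder.Language.elementarilyEquivalent_iff.1 hK _).2 hN) Subtype.val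
  simp only [← hmem] at hz
  let Z : Set (IsLocalRing.ResidueField v.valuationSubring) :=
    ⋃ i, {u | ∃ a : v.valuationSubring, v ((a : K) + z i) < 1 ∧ IsLocalRing.residue _ a = u}
  have hZfin : Z.Finite := Set.finite_iUnion fun i => Set.Subsingleton.finite <| by
    rintro _ ⟨a, ha, rfl⟩ _ ⟨b, hb, rfl⟩
    refine residue_eq_residue_of_valuation_sub_lt_one ?_
    rw [← add_sub_add_right_eq_sub (a : K) b (z i)]
    exact (v.map_sub _ _).trans_lt (max_lt ha hb)
  have hZ : (∀ a : v.valuationSubring, (a : K) ∈ Y → IsLocalRing.residue _ a ∈ Z) ∨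
      ∀ a : v.valuationSubring, IsLocalRing.residue _ a ∉ Z → (a : K) ∈ Y := by
    refine hz.imp (fun h a ha => ?_) fun h a ha => h a a.2 fun ⟨i, hi⟩ => ?_
    · obtain ⟨i, hi⟩ := h a a.2 ha
      exact Set.mem_iUnion.2 ⟨i, a, hi, rfl⟩
    · exact ha (Set.mem_iUnion.2 ⟨i, a, hi, rfl⟩)
  refine ⟨Z, hZfin, hZ, hZ.imp (fun h => hZfin.subset ?_) fun h => hZfin.subset fun u hu => ?_⟩
  · rintro _ ⟨a, ha, rfl⟩
    exact h a ha
  · obtain ⟨a, rfl⟩ := IsLocalRing.residue_surjective u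
    by_contra ha
    exact hu ⟨a, h a ha, rfl⟩
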